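/- The duality operation is isometric: for every n ≥ 0 and all f, g ∈ C_n, (𝒟_n(f), 𝒟_n(g))_n = (f, g)_n. -/

import Mathlib

open Matrix BigOperators

namespace HCPaper

open scoped Classical

/-- `gl F n` : the additive group of `n × n` matrices over `F`. -/
abbrev gl (F : Type) (n : ℕ) := Matrix (Fin n) (Fin n) F

variable {F : Type} [Field F] [Fintype F] [DecidableEq F]

/-- Conjugation (adjoint) action of `GL_n(F)` on `gl_n(F)`. -/
def conjM {n : ℕ} (g : Matrix.GeneralLinearGroup (Fin n) F) (x : gl F n) : gl F n :=
  (g : Matrix (Fin n) (Fin n) F) * x * ((g⁻¹ : Matrix.GeneralLinearGroup (Fin n) F) : Matrix (Fin n) (Fin n) F)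

/-- A function `f : gl_n(F) → ℂ` is invariant if it is constant on `GL_n(F)`-conjugacy orbits. -/
def Invariant (n : ℕ) (f : gl F n → ℂ) : Prop :=
  ∀ (g : Matrix.GeneralLinearGroup (Fin n) F) (x : gl F n), f (conjM g x) = f x

/-- Invariance for functions on `gl_k(F) × gl_l(F)` under `GL_k(F) × GL_l(F)`. -/
def Invariant₂ (k l : ℕ) (h : gl F k × gl F l → ℂ) : Prop :=
  ∀ (g₁ : Matrix.GeneralLinearGroup (Fin k) F) (g₂ : Matrix.GeneralLinearGroup (Fin l) F)
    (x : gl F k) (y : gl F l), h (conjM g₁ x, conjM g₂ y) = h (x, y)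

/-- Transport of matrices along an equality of sizes. -/
def castM {m n : ℕ} (h : m = n) (x : gl F m) : gl F n :=
  Matrix.reindex (finCongr h) (finCongr h) x

/-- Transport of functions along an equality of sizes. -/
def castFun {m n : ℕ} (h : m = n) (f : gl F m → ℂ) : gl F n → ℂ :=
  fun x => f (castM h.symm x)

/-- The block upper-triangular matrix `[x u; 0 y]`, viewed in `gl_{k+l}(F)`. -/
def but (k l : ℕ) (x : gl F k) (u : Matrix (Fin k) (Fin l) F) (y : gl F l) : gl F (k + l) :=
  Matrix.reindex finSumFinEquiv finSumFinEquiv (Matrix.fromBlocks x u 0 y)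

/-- The block lower-triangular matrix `[x 0; v y]`, viewed in `gl_{k+l}(F)`. -/
def blt (k l : ℕ) (x : gl F k) (v : Matrix (Fin l) (Fin k) F) (y : gl F l) : gl F (k + l) :=
  Matrix.reindex finSumFinEquiv finSumFinEquiv (Matrix.fromBlocks x 0 v y)

/-- View a matrix in `gl_{k+l}(F)` as a `2 × 2`-block matrix. -/
def blk (k l : ℕ) (m : gl F (k + l)) : Matrix (Fin k ⊕ Fin l) (Fin k ⊕ Fin l) F :=
  Matrix.reindex finSumFinEquiv.symm finSumFinEquiv.symm m

/-- Membership in `P_{k,l}` : being block upper triangular with blocks of sizes `k, l`. -/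
def IsBUT (k l : ℕ) (m : gl F (k + l)) : Prop := Matrix.toBlocks₂₁ (blk k l m) = 0

/-- The projection `π : P_{k,l} → gl_k(F) × gl_l(F)` deleting the off-diagonal block. -/
def proj (k l : ℕ) (m : gl F (k + l)) : gl F k × gl F l :=
  (Matrix.toBlocks₁₁ (blk k l m), Matrix.toBlocks₂₂ (blk k l m))

/-- The order of the group `P^×_{k,l}` of invertible block upper-triangular matrices. -/
noncomputable def Pcard (F : Type) [Field F] [Fintype F] [DecidableEq F] (k l : ℕ) : ℕ :=
  Nat.card {g : Matrix.GeneralLinearGroup (Fin (k + l)) F //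
    IsBUT k l (g : Matrix (Fin (k + l)) (Fin (k + l)) F)}

/-- Harish-Chandra restriction `*R^{k+l}_{k,l}`; by convention it is the identity
(under the canonical identifications) when `k = 0` or `l = 0`. -/
noncomputable def HCres (k l : ℕ) (f : gl F (k + l) → ℂ) : gl F k × gl F l → ℂ :=
  if hk : k = 0 then fun p => f (castM (by omega) p.2)
  else if hl : l = 0 then fun p => f (castM (by omega) p.1)
  else fun p =>
    ((Fintype.card F : ℂ) ^ (k * l))⁻¹ * ∑ u : Matrix (Fin k) (Fin l) F, f (but k l p.1 u p.2)

/-- Harish-Chandra induction `R^{k+l}_{k,l}`; by convention it is the identity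
(under the canonical identifications) when `k = 0` or `l = 0`. -/
noncomputable def HCind (k l : ℕ) (h : gl F k × gl F l → ℂ) : gl F (k + l) → ℂ :=
  if hk : k = 0 then fun z => h (0, castM (by omega) z)
  else if hl : l = 0 then fun z => h (castM (by omega) z, 0)
  else fun z =>
    ((Pcard F k l : ℂ))⁻¹ *
      ∑ g : Matrix.GeneralLinearGroup (Fin (k + l)) F,
        if IsBUT k l (conjM g z) then h (proj k l (conjM g z)) else 0

/-- The hermitian inner product on `C_n`. -/
noncomputable def inn (n : ℕ) (f g : gl F n → ℂ) : ℂ :=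
  ((Fintype.card (Matrix.GeneralLinearGroup (Fin n) F) : ℂ))⁻¹ *
    ∑ x : gl F n, f x * (starRingEnd ℂ) (g x)

/-- The hermitian inner product on invariant functions on `gl_k(F) × gl_l(F)`. -/
noncomputable def inn₂ (k l : ℕ) (f g : gl F k × gl F l → ℂ) : ℂ :=
  ((Fintype.card (Matrix.GeneralLinearGroup (Fin k) F) *
      Fintype.card (Matrix.GeneralLinearGroup (Fin l) F) : ℂ))⁻¹ *
    ∑ p : gl F k × gl F l, f p * (starRingEnd ℂ) (g p)

/-- `f ∈ C_n` is pre-cuspidal if all proper Harish-Chandra restrictions of `f` vanish. -/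
def PreCuspidal (n : ℕ) (f : gl F n → ℂ) : Prop :=
  ∀ (k l : ℕ), 1 ≤ k → 1 ≤ l → ∀ hkl : k + l = n, HCres k l (castFun hkl.symm f) = 0

/-- The composite `R_{(n_1,…,n_r)} ∘ *R_{(n_1,…,n_r)}` of the iterated two-block
Harish-Chandra induction and restriction along the composition `(n_1,…,n_r)`. -/
noncomputable def RcompRes : (L : List ℕ) → (gl F L.sum → ℂ) → gl F L.sum → ℂ
  | [], f => f
  | (k :: L), f =>
      castFun (List.sum_cons).symm
        (HCind k L.sum fun p =>
          RcompRes L (fun y => HCres k L.sum (castFun List.sum_cons f) (p.1, y)) p.2)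

/-- The duality operation `𝒟_n(f) = Σ_{(n_1,…,n_r) ⊨ n} (-1)^{n-r}
R_{(n_1,…,n_r)}(*R_{(n_1,…,n_r)} f)`, the sum over all compositions of `n`. -/
noncomputable def Dual (n : ℕ) (f : gl F n → ℂ) : gl F n → ℂ :=
  ∑ c : Composition n,
    ((-1 : ℂ)) ^ (n - c.length) •
      castFun c.blocks_sum (RcompRes c.blocks (castFun c.blocks_sum.symm f))

/-- `C_n`, the subspace of invariant functions, as a `ℂ`-submodule of all functions. -/
noncomputable def InvSub (F : Type) [Field F] (n : ℕ) : Submodule ℂ (gl F n → ℂ) where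
  carrier := {f | Invariant n f}
  add_mem' := by
    intro a b ha hb g x
    simp only [Pi.add_apply]
    rw [ha g x, hb g x]
  zero_mem' := by intro g x; rfl
  smul_mem' := by
    intro c f hf g x
    simp only [Pi.smul_apply]
    rw [hf g x]

/-- `χ` is the character of a finite-dimensional complex representation of the
additive group `gl_n(F)`. -/
def IsChar (n : ℕ) (χ : gl F n → ℂ) : Prop :=
  ∃ V : FDRep ℂ (Multiplicative (gl F n)),
    ∀ x : gl F n, FDRep.character V (Multiplicative.ofAdd x) = χ x

/-- An invariant character of `gl_n(F)`. -/
def IsInvChar (n : ℕ) (χ : gl F n → ℂ) : Prop := IsChar n χ ∧ Invariant n χ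

/-- A character of the additive group `gl_k(F) × gl_l(F)`. -/
def IsChar₂ (k l : ℕ) (χ : gl F k × gl F l → ℂ) : Prop :=
  ∃ V : FDRep ℂ (Multiplicative (gl F k × gl F l)),
    ∀ p : gl F k × gl F l, FDRep.character V (Multiplicative.ofAdd p) = χ p

/-- An invariant character of `gl_k(F) × gl_l(F)`. -/
def IsInvChar₂ (k l : ℕ) (χ : gl F k × gl F l → ℂ) : Prop := IsChar₂ k l χ ∧ Invariant₂ k l χ

/-- An irreducible invariant character: a nonzero invariant character which is not
the sum of two nonzero invariant characters. -/
def IrrInvChar (n : ℕ) (χ : gl F n → ℂ) : Prop :=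
  IsInvChar n χ ∧ χ ≠ 0 ∧
    ¬ ∃ χ₁ χ₂ : gl F n → ℂ, IsInvChar n χ₁ ∧ IsInvChar n χ₂ ∧ χ₁ ≠ 0 ∧ χ₂ ≠ 0 ∧ χ = χ₁ + χ₂


end HCPaper

namespace HCPaper
open scoped Classical

/-! ### Averages -/

section avg

noncomputable def avg {G : Type} [Fintype G] (φ : G → ℂ) : ℂ :=
  (Fintype.card G : ℂ)⁻¹ * ∑ g, φ g

theorem avg_equiv {G H : Type} [Fintype G] [Fintype H] (e : G ≃ H) (φ : H → ℂ) :
    avg (fun g => φ (e g)) = avg φ := by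
  unfold avg
  rw [Fintype.card_congr e, Equiv.sum_comp e φ]

theorem avg_congr {G : Type} [Fintype G] {φ ψ : G → ℂ} (h : ∀ g, φ g = ψ g) :
    avg φ = avg ψ := by
  rw [funext h]

theorem avg_const {G : Type} [Fintype G] [Nonempty G] (c : ℂ) :
    avg (fun _ : G => c) = c := by
  unfold avg
  have : (Fintype.card G : ℂ) ≠ 0 := by exact_mod_cast Fintype.card_ne_zero
  simp [this]

theorem avg_prod {G H : Type} [Fintype G] [Fintype H] (φ : G × H → ℂ) :
    avg φ = avg fun g => avg fun h => φ (g, h) := by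
  unfold avg
  rw [Fintype.card_prod, Fintype.sum_prod_type, ← Finset.mul_sum]
  push_cast
  rw [mul_inv]; ring

theorem avg_comm {G H : Type} [Fintype G] [Fintype H] (φ : G → H → ℂ) :
    (avg fun g => avg fun h => φ g h) = avg fun h => avg fun g => φ g h := by
  unfold avg
  simp only [← Finset.mul_sum]
  rw [Finset.sum_comm]; ring

theorem avg_sum {G ι : Type} [Fintype G] [Fintype ι] (φ : ι → G → ℂ) :
    (avg fun g => ∑ i, φ i g) = ∑ i, avg (φ i) := by
  unfold avg
  rw [Finset.sum_comm, Finset.mul_sum]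

theorem avg_mul {G : Type} [Fintype G] (c : ℂ) (φ : G → ℂ) :
    (avg fun g => c * φ g) = c * avg φ := by
  unfold avg
  rw [← Finset.mul_sum]; ring

/-- Fibres of a surjective homomorphism all have the size of the kernel. -/
theorem card_eq_of_surj {G H : Type} [AddGroup G] [AddGroup H] [Fintype G] [Fintype H]
    (p : G →+ H) (hp : Function.Surjective p) :
    (∀ h, (Finset.univ.filter fun g => p g = h).card
      = (Finset.univ.filter fun g => p g = 0).card) ∧
    Fintype.card G = Fintype.card H * (Finset.univ.filter fun g => p g = 0).card := by
  have h1 : ∀ h, (Finset.univ.filter fun g => p g = h).card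
      = (Finset.univ.filter fun g => p g = 0).card := by
    intro h
    obtain ⟨g0, rfl⟩ := hp h
    refine Finset.card_bij' (fun g _ => g - g0) (fun g _ => g + g0) ?_ ?_ ?_ ?_ <;> simp
    intro a ha; rw [ha, sub_self]
  refine ⟨h1, ?_⟩
  have := Finset.card_eq_sum_card_fiberwise (s := (Finset.univ : Finset G))
    (t := (Finset.univ : Finset H)) (f := p) (by simp [Set.MapsTo])
  rw [← Finset.card_univ, this, Finset.sum_congr rfl (fun h _ => h1 h)]
  simp

theorem avg_surj {G H : Type} [AddGroup G] [AddGroup H] [Fintype G] [Fintype H]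
    (p : G →+ H) (hp : Function.Surjective p) (φ : H → ℂ) :
    avg (fun g => φ (p g)) = avg φ := by
  obtain ⟨h1, h2⟩ := card_eq_of_surj p hp
  unfold avg
  have hs : ∑ g, φ (p g) = ((Finset.univ.filter fun g => p g = 0).card : ℂ) * ∑ h, φ h := by
    rw [← Finset.sum_fiberwise (s := Finset.univ) (g := p), Finset.mul_sum]
    refine Finset.sum_congr rfl fun h _ => ?_
    rw [← h1 h, Finset.sum_congr rfl (g := fun _ => φ h)]
    · simp
    · intro g hg; simp at hg; rw [hg]
  rw [hs, h2]
  have hne : ((Finset.univ.filter fun g => p g = 0).card : ℂ) ≠ 0 := by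
    have : 0 < (Finset.univ.filter fun g => p g = 0).card :=
      Finset.card_pos.mpr ⟨0, by simp⟩
    exact_mod_cast this.ne'
  push_cast
  field_simp

end avg

/-! ### Objects: a finite vector space with an endomorphism -/

structure Obj (F : Type) [Field F] where
  V : Type
  [acg : AddCommGroup V]
  [mod : Module F V]
  [fin : Finite V]
  x : V →ₗ[F] V

attribute [instance] Obj.acg Obj.mod Obj.fin

section obj
variable {F : Type} [Field F]

instance finHom {V W : Type} [AddCommGroup V] [AddCommGroup W] [Module F V] [Module F W]
    [Finite V] [Finite W] : Finite (V →ₗ[F] W) := DFunLike.finite _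

noncomputable instance ftHom {V W : Type} [AddCommGroup V] [AddCommGroup W] [Module F V] [Module F W]
    [Finite V] [Finite W] : Fintype (V →ₗ[F] W) := Fintype.ofFinite _

instance finQuot {V : Type} [AddCommGroup V] [Module F V] [Finite V] (W : Submodule F V) :
    Finite (V ⧸ W) := Finite.of_surjective _ W.mkQ_surjective

/-- stable subspaces -/
abbrev Stab (A : Obj F) : Type := {W : Submodule F A.V // W ≤ W.comap A.x}

noncomputable instance ftStab (A : Obj F) : Fintype (Stab A) := Fintype.ofFinite _

def Obj.sub (A : Obj F) (W : Stab A) : Obj F := ⟨W.1, A.x.restrict W.2⟩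
def Obj.quo (A : Obj F) (W : Stab A) : Obj F := ⟨A.V ⧸ W.1, W.1.mapQ W.1 A.x W.2⟩
noncomputable def Obj.dim (A : Obj F) : ℕ := Module.finrank F A.V

/-- the extension of `B` by `A` given by `u` -/
def Obj.ext (A B : Obj F) (u : B.V →ₗ[F] A.V) : Obj F :=
  ⟨A.V × B.V, LinearMap.prod (A.x ∘ₗ LinearMap.fst F A.V B.V + u ∘ₗ LinearMap.snd F A.V B.V)
    (B.x ∘ₗ LinearMap.snd F A.V B.V)⟩

theorem ext_x_apply (A B : Obj F) (u : B.V →ₗ[F] A.V) (p : A.V × B.V) :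
    (A.ext B u).x p = (A.x p.1 + u p.2, B.x p.2) := by
  rfl

def Iso (A B : Obj F) : Prop := ∃ e : A.V ≃ₗ[F] B.V, ∀ v, e (A.x v) = B.x (e v)

theorem Iso.refl (A : Obj F) : Iso A A := ⟨LinearEquiv.refl F _, fun _ => rfl⟩
theorem Iso.symm {A B : Obj F} (h : Iso A B) : Iso B A := by
  obtain ⟨e, he⟩ := h
  exact ⟨e.symm, fun v => by rw [LinearEquiv.symm_apply_eq, he, e.apply_symm_apply]⟩
theorem Iso.trans {A B C : Obj F} (h : Iso A B) (h' : Iso B C) : Iso A C := by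
  obtain ⟨e, he⟩ := h
  obtain ⟨e', he'⟩ := h'
  exact ⟨e.trans e', fun v => by simp [he, he']⟩

theorem Iso.dim {A B : Obj F} (h : Iso A B) : A.dim = B.dim := h.choose.finrank_eq

/-- class functions -/
def Cls (f : Obj F → ℂ) : Prop := ∀ A B, Iso A B → f A = f B

theorem dim_sub_quo (A : Obj F) (W : Stab A) : (A.sub W).dim + (A.quo W).dim = A.dim := by
  have := Submodule.finrank_quotient_add_finrank W.1
  rw [add_comm]
  exact this

theorem dim_ext (A B : Obj F) (u : B.V →ₗ[F] A.V) : (A.ext B u).dim = A.dim + B.dim :=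
  Module.finrank_prod

/-- transport stable subspaces along an isomorphism -/
def stabEquiv {A B : Obj F} (e : A.V ≃ₗ[F] B.V) (he : ∀ v, e (A.x v) = B.x (e v)) :
    Stab A ≃ Stab B where
  toFun W := ⟨W.1.map e.toLinearMap, by
    rintro _ ⟨v, hv, rfl⟩
    exact ⟨A.x v, W.2 hv, he v⟩⟩
  invFun W := ⟨W.1.comap e.toLinearMap, by
    intro v hv
    change e (A.x v) ∈ W.1
    rw [he]; exact W.2 hv⟩
  left_inv W := by
    apply Subtype.ext
    exact Submodule.comap_map_eq_of_injective e.injective _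
  right_inv W := by
    apply Subtype.ext
    exact Submodule.map_comap_eq_of_surjective e.surjective _

theorem iso_sub {A B : Obj F} (e : A.V ≃ₗ[F] B.V) (he : ∀ v, e (A.x v) = B.x (e v))
    (W : Stab A) (W' : Stab B) (h : W.1.map e.toLinearMap = W'.1) : Iso (A.sub W) (B.sub W') := by
  refine ⟨e.ofSubmodules W.1 W'.1 h, fun v => ?_⟩
  apply Subtype.ext
  exact he v.1

theorem iso_quo {A B : Obj F} (e : A.V ≃ₗ[F] B.V) (he : ∀ v, e (A.x v) = B.x (e v))
    (W : Stab A) (W' : Stab B) (h : W.1.map e.toLinearMap = W'.1) : Iso (A.quo W) (B.quo W') := by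
  refine ⟨Submodule.Quotient.equiv W.1 W'.1 e h, fun v => ?_⟩
  obtain ⟨v, rfl⟩ := W.1.mkQ_surjective v
  change W'.1.mkQ (e (A.x v)) = W'.1.mkQ (B.x (e v))
  rw [he]

/-- the product -/
noncomputable def mul (h : Obj F → Obj F → ℂ) (A : Obj F) : ℂ :=
  ∑ W : Stab A, h (A.sub W) (A.quo W)

/-- two-variable class functions -/
def Cls2 (h : Obj F → Obj F → ℂ) : Prop := ∀ A A' B B', Iso A A' → Iso B B' → h A B = h A' B'

theorem mul_cls {h : Obj F → Obj F → ℂ} (hh : Cls2 h) : Cls (mul h) := by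
  rintro A B ⟨e, he⟩
  unfold mul
  rw [← Equiv.sum_comp (stabEquiv e he)]
  exact Finset.sum_congr rfl fun W _ =>
    hh _ _ _ _ (iso_sub e he W _ rfl) (iso_quo e he W _ rfl)

/-- the coproduct -/
noncomputable def cop (f : Obj F → ℂ) (A B : Obj F) : ℂ := avg fun u => f (A.ext B u)

theorem iso_ext {A A' B B' : Obj F} (e : A.V ≃ₗ[F] A'.V) (he : ∀ v, e (A.x v) = A'.x (e v))
    (e' : B.V ≃ₗ[F] B'.V) (he' : ∀ v, e' (B.x v) = B'.x (e' v))
    (u : B.V →ₗ[F] A.V) (u' : B'.V →ₗ[F] A'.V) (hu : ∀ v, e (u v) = u' (e' v)) :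
    Iso (A.ext B u) (A'.ext B' u') := by
  refine ⟨e.prodCongr e', fun v => ?_⟩
  refine Prod.ext ?_ (he' v.2)
  change e (A.x v.1 + u v.2) = A'.x (e v.1) + u' (e' v.2)
  rw [map_add, he, hu]

theorem cop_cls {f : Obj F → ℂ} (hf : Cls f) : Cls2 (cop f) := by
  rintro A A' B B' ⟨e, he⟩ ⟨e', he'⟩
  unfold cop
  rw [← avg_equiv (LinearEquiv.arrowCongr e' e).toEquiv]
  refine avg_congr fun u => hf _ _ (iso_ext e he e' he' _ _ fun v => ?_)
  simp

theorem Cls2.left {h : Obj F → Obj F → ℂ} (hh : Cls2 h) (B : Obj F) : Cls (fun A => h A B) :=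
  fun _ _ i => hh _ _ _ _ i (Iso.refl _)
theorem Cls2.right {h : Obj F → Obj F → ℂ} (hh : Cls2 h) (A : Obj F) : Cls (h A) :=
  fun _ _ i => hh _ _ _ _ (Iso.refl _) i

/-- coassociativity -/
theorem cop_assoc {f : Obj F → ℂ} (hf : Cls f) (A B C : Obj F) :
    cop (fun P => cop f P C) A B = cop (cop f A) B C := by
  -- u : B → A, v : C → A × B;   v : C → B, w : B × C → A
  unfold cop
  have h1 : ∀ (u : B.V →ₗ[F] A.V),
      (avg fun v : C.V →ₗ[F] (A.ext B u).V => f ((A.ext B u).ext C v))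
      = avg fun v : C.V →ₗ[F] A.V => avg fun w : C.V →ₗ[F] B.V =>
          f ((A.ext B u).ext C (LinearMap.prod v w)) := by
    intro u
    rw [← avg_prod (fun p : (C.V →ₗ[F] A.V) × (C.V →ₗ[F] B.V) =>
      f ((A.ext B u).ext C (LinearMap.prod p.1 p.2)))]
    exact (avg_equiv (LinearMap.prodEquiv F (M := C.V) (M₂ := A.V) (M₃ := B.V)).toEquiv
      (fun v => f ((A.ext B u).ext C v))).symm
  have h2 : ∀ (w : C.V →ₗ[F] B.V),
      (avg fun v : (B.ext C w).V →ₗ[F] A.V => f (A.ext (B.ext C w) v))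
      = avg fun u : B.V →ₗ[F] A.V => avg fun v : C.V →ₗ[F] A.V =>
          f (A.ext (B.ext C w) (LinearMap.coprod u v)) := by
    intro w
    rw [← avg_prod (fun p : (B.V →ₗ[F] A.V) × (C.V →ₗ[F] A.V) =>
      f (A.ext (B.ext C w) (LinearMap.coprod p.1 p.2)))]
    exact (avg_equiv (LinearMap.coprodEquiv F (M := B.V) (M₂ := C.V) (M₃ := A.V)).toEquiv
      (fun v => f (A.ext (B.ext C w) v))).symm
  rw [avg_congr h1, avg_congr h2, avg_comm (G := C.V →ₗ[F] B.V)]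
  refine avg_congr fun u => ?_
  rw [avg_comm]
  refine avg_congr fun w => avg_congr fun v => hf _ _ ?_
  refine ⟨LinearEquiv.prodAssoc F A.V B.V C.V, fun p => ?_⟩
  obtain ⟨⟨a, b⟩, c⟩ := p
  refine Prod.ext ?_ rfl
  exact add_assoc (A.x a) (u b) (v c)

end obj
end HCPaper

namespace HCPaper
open scoped Classical

theorem sum_subtype_dite {α : Type} {p : α → Prop} [Fintype α] [Fintype {a // p a}]
    (g : {a // p a} → ℂ) : ∑ a, g a = ∑ a, if h : p a then g ⟨a, h⟩ else 0 := by
  have h1 : ∑ a, g a = ∑ a : {a // p a}, (fun a => if h : p a then g ⟨a, h⟩ else 0) a.1 := by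
    refine Finset.sum_congr rfl fun a _ => ?_
    simp only [dif_pos a.2]
  rw [h1, ← Finset.sum_subtype (Finset.univ.filter p) (by simp)
    (fun a => if h : p a then g ⟨a, h⟩ else 0), Finset.sum_filter_of_ne]
  intro a _ ha
  by_contra hp
  exact ha (dif_neg hp)

section obj
variable {F : Type} [Field F]

noncomputable instance ftSubm {V : Type} [AddCommGroup V] [Module F V] [Finite V] :
    Fintype (Submodule F V) := Fintype.ofFinite _

theorem iso_sub_of (A C : Obj F) (W : Stab A) (j : C.V →ₗ[F] A.V) (hj : Function.Injective j)
    (hr : ∀ a, a ∈ W.1 ↔ ∃ c, j c = a) (hx : ∀ c, j (C.x c) = A.x (j c)) :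
    Iso C (A.sub W) := by
  have hmem : ∀ c, j c ∈ W.1 := fun c => (hr _).2 ⟨c, rfl⟩
  refine ⟨LinearEquiv.ofBijective (j.codRestrict W.1 hmem) ⟨?_, ?_⟩, fun c => ?_⟩
  · intro a b hab
    exact hj (congrArg Subtype.val hab)
  · rintro ⟨a, ha⟩
    obtain ⟨c, hc⟩ := (hr a).1 ha
    exact ⟨c, Subtype.ext hc⟩
  · exact Subtype.ext (hx c)

theorem iso_quo_of (A C : Obj F) (W : Stab A) (p : A.V →ₗ[F] C.V) (hp : Function.Surjective p)
    (hr : ∀ a, a ∈ W.1 ↔ p a = 0) (hx : ∀ a, p (A.x a) = C.x (p a)) :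
    Iso (A.quo W) C := by
  have hker : W.1 = LinearMap.ker p := by ext a; simp [hr]
  refine ⟨LinearEquiv.ofBijective (W.1.liftQ p hker.le) ⟨?_, ?_⟩, fun c => ?_⟩
  · rw [← LinearMap.ker_eq_bot, Submodule.ker_liftQ_eq_bot' _ _ hker]
  · intro c
    obtain ⟨a, rfl⟩ := hp c
    exact ⟨W.1.mkQ a, rfl⟩
  · obtain ⟨a, rfl⟩ := W.1.mkQ_surjective c
    exact hx a

section shear
variable {A B : Type} [AddCommGroup A] [AddCommGroup B] [Module F A] [Module F B]

def shear (t : B →ₗ[F] A) : (A × B) ≃ₗ[F] (A × B) where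
  toFun p := (p.1 + t p.2, p.2)
  invFun p := (p.1 - t p.2, p.2)
  map_add' p q := by ext <;> simp; abel
  map_smul' c p := by ext <;> simp
  left_inv p := by simp
  right_inv p := by simp

theorem mem_shear (t : B →ₗ[F] A) (A1 : Submodule F A) (B1 : Submodule F B) (p : A × B) :
    p ∈ (A1.prod B1).map (shear t).toLinearMap ↔ p.1 - t p.2 ∈ A1 ∧ p.2 ∈ B1 := by
  constructor
  · rintro ⟨q, ⟨h1, h2⟩, rfl⟩
    exact ⟨by change q.1 + t q.2 - t q.2 ∈ A1; simpa using h1, h2⟩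
  · rintro ⟨h1, h2⟩
    exact ⟨(p.1 - t p.2, p.2), ⟨h1, h2⟩, Prod.ext (sub_add_cancel _ _) rfl⟩

def typ (W : Submodule F (A × B)) : Submodule F A × Submodule F B :=
  (W.comap (LinearMap.inl F A B), W.map (LinearMap.snd F A B))

theorem typ_shear (t : B →ₗ[F] A) (A1 : Submodule F A) (B1 : Submodule F B) :
    typ ((A1.prod B1).map (shear t).toLinearMap) = (A1, B1) := by
  refine Prod.ext ?_ ?_
  · ext a
    change (a, (0 : B)) ∈ (A1.prod B1).map (shear t).toLinearMap ↔ _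
    rw [mem_shear]
    simp
  · ext b
    constructor
    · rintro ⟨p, hp, rfl⟩
      exact ((mem_shear _ _ _ _).1 hp).2
    · intro hb
      exact ⟨(t b, b), (mem_shear _ _ _ _).2 ⟨by simp, hb⟩, rfl⟩

theorem exists_shear (W : Submodule F (A × B)) (A1 : Submodule F A) (B1 : Submodule F B)
    (h : typ W = (A1, B1)) : ∃ t : B →ₗ[F] A, (A1.prod B1).map (shear t).toLinearMap = W := by
  have hA : W.comap (LinearMap.inl F A B) = A1 := congrArg Prod.fst h
  have hB : W.map (LinearMap.snd F A B) = B1 := congrArg Prod.snd h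
  have hmem : ∀ w : W, (LinearMap.snd F A B ∘ₗ W.subtype) w ∈ B1 := fun w => by
    rw [← hB]; exact ⟨w.1, w.2, rfl⟩
  let π : W →ₗ[F] B1 := (LinearMap.snd F A B ∘ₗ W.subtype).codRestrict B1 hmem
  have hπ : LinearMap.range π = ⊤ := by
    rw [LinearMap.range_eq_top]
    rintro ⟨b, hb⟩
    rw [← hB] at hb
    obtain ⟨w, hw, hwb⟩ := hb
    exact ⟨⟨w, hw⟩, Subtype.ext hwb⟩
  obtain ⟨σ, hσ⟩ := π.exists_rightInverse_of_surjective hπ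
  obtain ⟨t, ht⟩ := LinearMap.exists_extend (LinearMap.fst F A B ∘ₗ W.subtype ∘ₗ σ)
  have key : ∀ b (hb : b ∈ B1), (t b, b) ∈ W := by
    intro b hb
    have h1 : t b = (σ ⟨b, hb⟩).1.1 := LinearMap.congr_fun ht ⟨b, hb⟩
    have h2 : (σ ⟨b, hb⟩).1.2 = b := congrArg Subtype.val (LinearMap.congr_fun hσ ⟨b, hb⟩)
    have h3 : (t b, b) = (σ ⟨b, hb⟩).1 := Prod.ext h1 h2.symm
    rw [h3]; exact (σ ⟨b, hb⟩).2
  refine ⟨t, ?_⟩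
  have hA' : ∀ a, a ∈ A1 ↔ (a, (0 : B)) ∈ W := fun a => by rw [← hA]; rfl
  ext p
  rw [mem_shear, hA']
  constructor
  · rintro ⟨h1, h2⟩
    have := W.add_mem h1 (key _ h2)
    simpa using this
  · intro hp
    have hb : p.2 ∈ B1 := by rw [← hB]; exact ⟨p, hp, rfl⟩
    refine ⟨?_, hb⟩
    have := W.sub_mem hp (key _ hb)
    convert this using 1
    ext <;> simp

theorem shear_eq_iff (t t0 : B →ₗ[F] A) (A1 : Submodule F A) (B1 : Submodule F B) :
    (A1.prod B1).map (shear t).toLinearMap = (A1.prod B1).map (shear t0).toLinearMap ↔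
      t - t0 ∈ Submodule.compatibleMaps B1 A1 := by
  constructor
  · intro h b hb
    have : (t b, b) ∈ (A1.prod B1).map (shear t0).toLinearMap := by
      rw [← h, mem_shear]; exact ⟨by simp, hb⟩
    exact ((mem_shear _ _ _ _).1 this).1
  · intro h
    ext p
    rw [mem_shear, mem_shear]
    refine and_congr_left fun hb => ?_
    have h1 : t p.2 - t0 p.2 ∈ A1 := h hb
    constructor
    · intro h2
      have := A1.add_mem h2 h1
      simpa using this
    · intro h2
      have := A1.sub_mem h2 h1
      simpa using this

/-- restriction to a submodule and quotient of a compatible map -/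
def compatPair (A1 : Submodule F A) (B1 : Submodule F B) :
    Submodule.compatibleMaps B1 A1 →+ (B1 →ₗ[F] A1) × ((B ⧸ B1) →ₗ[F] (A ⧸ A1)) where
  toFun u := (u.1.restrict u.2, B1.mapQ A1 u.1 u.2)
  map_zero' := by
    refine Prod.ext ?_ ?_
    · ext; rfl
    · ext; rfl
  map_add' u v := by
    refine Prod.ext ?_ ?_
    · ext; rfl
    · ext; rfl

theorem compatPair_surj (A1 : Submodule F A) (B1 : Submodule F B) :
    Function.Surjective (compatPair A1 B1) := by
  rintro ⟨u1, u2⟩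
  obtain ⟨u1', h1⟩ := LinearMap.exists_extend (A1.subtype ∘ₗ u1)
  obtain ⟨π, hπ⟩ := B1.subtype.exists_leftInverse_of_injective B1.ker_subtype
  obtain ⟨σ, hσ⟩ := A1.mkQ.exists_rightInverse_of_surjective (by simp)
  let u : B →ₗ[F] A := A1.subtype ∘ₗ u1 ∘ₗ π + σ ∘ₗ u2 ∘ₗ B1.mkQ
  have hu1 : ∀ b : B1, u b.1 = (u1 b).1 := by
    intro b
    have e1 : π b.1 = b := LinearMap.congr_fun hπ b
    have e2 : B1.mkQ b.1 = 0 := by simp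
    change (u1 (π b.1)).1 + σ (u2 (B1.mkQ b.1)) = _
    rw [e1, e2, map_zero, map_zero, add_zero]
  have hu : u ∈ Submodule.compatibleMaps B1 A1 := by
    intro b hb
    change u b ∈ A1
    rw [hu1 ⟨b, hb⟩]
    exact (u1 _).2
  refine ⟨⟨u, hu⟩, Prod.ext ?_ ?_⟩
  · ext b
    exact hu1 b
  · ext b
    change A1.mkQ (u b) = u2 (B1.mkQ b)
    have e1 : A1.mkQ (σ (u2 (B1.mkQ b))) = u2 (B1.mkQ b) := LinearMap.congr_fun hσ _
    have e2 : A1.mkQ ((u1 (π b)).1) = 0 := by simp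
    change A1.mkQ ((u1 (π b)).1 + σ (u2 (B1.mkQ b))) = _
    rw [map_add, e1, e2, zero_add]

variable [Finite A] [Finite B]

theorem sum_typ (A1 : Submodule F A) (B1 : Submodule F B) (φ : Submodule F (A × B) → ℂ) :
    ∑ W with typ W = (A1, B1), φ W =
      (Fintype.card (Submodule.compatibleMaps B1 A1) : ℂ)⁻¹ *
        ∑ t : B →ₗ[F] A, φ ((A1.prod B1).map (shear t).toLinearMap) := by
  have h1 := Finset.sum_fiberwise_of_maps_to (s := (Finset.univ : Finset (B →ₗ[F] A)))
    (t := Finset.univ.filter fun W : Submodule F (A × B) => typ W = (A1, B1))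
    (g := fun t => (A1.prod B1).map (shear t).toLinearMap)
    (by intro t _; simp [typ_shear])
    (fun t => φ ((A1.prod B1).map (shear t).toLinearMap))
  rw [← h1, Finset.mul_sum]
  refine Finset.sum_congr rfl fun W hW => ?_
  rw [Finset.mem_filter] at hW
  obtain ⟨t0, ht0⟩ := exists_shear W A1 B1 hW.2
  rw [Finset.sum_congr rfl (g := fun _ => φ W)
    (fun t ht => by rw [(Finset.mem_filter.1 ht).2]), Finset.sum_const, nsmul_eq_mul]
  have hc : (Finset.univ.filter fun t : B →ₗ[F] A =>
      (A1.prod B1).map (shear t).toLinearMap = W).card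
      = Fintype.card (Submodule.compatibleMaps B1 A1) := by
    rw [← Finset.card_univ]
    refine Finset.card_bij' (fun t ht => ⟨t - t0, (shear_eq_iff t t0 A1 B1).1
      (by rw [ht0]; exact (Finset.mem_filter.1 ht).2)⟩) (fun k _ => k.1 + t0) ?_ ?_ ?_ ?_
    · simp
    · intro k _
      simp only [Finset.mem_filter, Finset.mem_univ, true_and]
      rw [← ht0, shear_eq_iff]
      simpa using k.2
    · intro t _; simp
    · intro k _; simp
  rw [hc, ← mul_assoc, inv_mul_cancel₀, one_mul]
  exact_mod_cast Fintype.card_ne_zero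

end shear

/-- extension by zero of the summand of the product -/
noncomputable def Hx (h : Obj F → Obj F → ℂ) (A : Obj F) (W : Submodule F A.V) : ℂ :=
  if hs : W ≤ W.comap A.x then h (A.sub ⟨W, hs⟩) (A.quo ⟨W, hs⟩) else 0

theorem mul_eq (h : Obj F → Obj F → ℂ) (A : Obj F) : mul h A = ∑ W, Hx h A W :=
  sum_subtype_dite _

theorem Hx_iso {h : Obj F → Obj F → ℂ} (hh : Cls2 h) {A B : Obj F} (e : A.V ≃ₗ[F] B.V)
    (he : ∀ v, e (A.x v) = B.x (e v)) (W : Submodule F A.V) :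
    Hx h A W = Hx h B (W.map e.toLinearMap) := by
  unfold Hx
  by_cases hs : W ≤ W.comap A.x
  · have hs' : W.map e.toLinearMap ≤ (W.map e.toLinearMap).comap B.x :=
      (stabEquiv e he ⟨W, hs⟩).2
    rw [dif_pos hs, dif_pos hs']
    exact hh _ _ _ _ (iso_sub e he _ _ rfl) (iso_quo e he _ _ rfl)
  · have hs' : ¬ W.map e.toLinearMap ≤ (W.map e.toLinearMap).comap B.x := by
      intro hs'
      apply hs
      have := ((stabEquiv e he).symm ⟨_, hs'⟩).2
      have e1 : ((stabEquiv e he).symm ⟨_, hs'⟩).1 = W :=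
        Submodule.comap_map_eq_of_injective e.injective _
      rwa [e1] at this
    rw [dif_neg hs, dif_neg hs']

/-- stability of `A1 × B1` in an extension -/
theorem stab_prod_iff (A B : Obj F) (u : B.V →ₗ[F] A.V) (A1 : Submodule F A.V)
    (B1 : Submodule F B.V) :
    ((A1.prod B1 : Submodule F (A.V × B.V)) ≤ Submodule.comap (A.ext B u).x (A1.prod B1)) ↔
      (A1 ≤ A1.comap A.x ∧ B1 ≤ B1.comap B.x ∧ u ∈ Submodule.compatibleMaps B1 A1) := by
  constructor
  · intro h
    have key : ∀ a ∈ A1, ∀ b ∈ B1, A.x a + u b ∈ A1 ∧ B.x b ∈ B1 := fun a ha b hb =>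
      h (show (a, b) ∈ A1.prod B1 from ⟨ha, hb⟩)
    refine ⟨fun a ha => ?_, fun b hb => (key 0 A1.zero_mem b hb).2, fun b hb => ?_⟩
    · simpa using (key a ha 0 B1.zero_mem).1
    · simpa using (key 0 A1.zero_mem b hb).1
  · rintro ⟨h1, h2, h3⟩ ⟨a, b⟩ ⟨ha, hb⟩
    exact ⟨A1.add_mem (h1 ha) (h3 hb), h2 hb⟩

theorem Hx_prod {h : Obj F → Obj F → ℂ} (hh : Cls2 h) (A B : Obj F) (A1 : Stab A) (B1 : Stab B)
    (u : Submodule.compatibleMaps B1.1 A1.1) :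
    Hx h (A.ext B u.1) (A1.1.prod B1.1 : Submodule F (A.V × B.V)) =
      h ((A.sub A1).ext (B.sub B1) (compatPair A1.1 B1.1 u).1)
        ((A.quo A1).ext (B.quo B1) (compatPair A1.1 B1.1 u).2) := by
  have hs := (stab_prod_iff A B u.1 A1.1 B1.1).2 ⟨A1.2, B1.2, u.2⟩
  refine (dif_pos hs).trans ?_
  refine hh _ _ _ _ (Iso.symm ?_) ?_
  · refine iso_sub_of _ _ _ (A1.1.subtype.prodMap B1.1.subtype) ?_ ?_ ?_
    · rintro ⟨a, b⟩ ⟨a', b'⟩ hab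
      exact Prod.ext (Subtype.ext (congrArg Prod.fst hab)) (Subtype.ext (congrArg Prod.snd hab))
    · rintro ⟨a, b⟩
      constructor
      · rintro ⟨ha, hb⟩
        exact ⟨(⟨a, ha⟩, ⟨b, hb⟩), rfl⟩
      · rintro ⟨⟨a', b'⟩, hc⟩
        have e1 : a'.1 = a := congrArg Prod.fst hc
        have e2 : b'.1 = b := congrArg Prod.snd hc
        exact ⟨e1 ▸ a'.2, e2 ▸ b'.2⟩
    · rintro ⟨a, b⟩
      rfl
  · refine iso_quo_of _ _ _ (A1.1.mkQ.prodMap B1.1.mkQ) ?_ ?_ ?_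
    · rintro ⟨a, b⟩
      obtain ⟨a, rfl⟩ := A1.1.mkQ_surjective a
      obtain ⟨b, rfl⟩ := B1.1.mkQ_surjective b
      exact ⟨(a, b), rfl⟩
    · rintro ⟨a, b⟩
      have e1 := (Submodule.Quotient.mk_eq_zero A1.1 (x := a)).symm
      have e2 := (Submodule.Quotient.mk_eq_zero B1.1 (x := b)).symm
      refine (and_congr e1 e2).trans ⟨fun h => Prod.ext h.1 h.2, fun h => ?_⟩
      exact ⟨congrArg Prod.fst h, congrArg Prod.snd h⟩
    · rintro ⟨a, b⟩
      rfl

/-- the Mackey formula -/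
theorem mackey {h : Obj F → Obj F → ℂ} (hh : Cls2 h) (A B : Obj F) :
    cop (mul h) A B = ∑ A1 : Stab A, ∑ B1 : Stab B, avg fun u1 => avg fun u2 =>
      h ((A.sub A1).ext (B.sub B1) u1) ((A.quo A1).ext (B.quo B1) u2) := by
  -- the contribution of a type
  let φ : (B.V →ₗ[F] A.V) → Submodule F (A.V × B.V) → ℂ := fun u W => Hx h (A.ext B u) W
  have hφ : ∀ t u W, φ (u + t ∘ₗ B.x - A.x ∘ₗ t) (W.map (shear t).toLinearMap) = φ u W := by
    intro t u W
    refine (Hx_iso hh (A := A.ext B u) (B := A.ext B (u + t ∘ₗ B.x - A.x ∘ₗ t))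
      (shear t) ?_ W).symm
    rintro ⟨a, b⟩
    refine Prod.ext ?_ rfl
    change A.x a + u b + t (B.x b) = A.x (a + t b) + (u b + t (B.x b) - A.x (t b))
    rw [map_add]; abel
  have h1 : ∀ (A1 : Submodule F A.V) (B1 : Submodule F B.V),
      (∑ u, ∑ W with typ W = (A1, B1), φ u W) =
        (Fintype.card (B.V →ₗ[F] A.V) : ℂ) *
        ((Fintype.card (Submodule.compatibleMaps B1 A1) : ℂ)⁻¹ * ∑ u, φ u (A1.prod B1)) := by
    intro A1 B1
    rw [Finset.sum_congr rfl fun u _ => sum_typ A1 B1 (φ u), ← Finset.mul_sum, Finset.sum_comm]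
    have : ∀ t : B.V →ₗ[F] A.V, ∑ u, φ u ((A1.prod B1).map (shear t).toLinearMap)
        = ∑ u, φ u (A1.prod B1) := by
      intro t
      rw [← Equiv.sum_comp (Equiv.addRight (t ∘ₗ B.x - A.x ∘ₗ t))]
      refine Finset.sum_congr rfl fun u _ => ?_
      rw [← hφ t u, Equiv.coe_addRight, add_sub_assoc]
    rw [Finset.sum_congr rfl fun t _ => this t, Finset.sum_const, Finset.card_univ, nsmul_eq_mul]
    ring
  have h2 : cop (mul h) A B = ∑ A1 : Submodule F A.V, ∑ B1 : Submodule F B.V,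
      (Fintype.card (Submodule.compatibleMaps B1 A1) : ℂ)⁻¹ * ∑ u, φ u (A1.prod B1) := by
    unfold cop avg
    have : ∀ u, mul h (A.ext B u) = ∑ p : Submodule F A.V × Submodule F B.V,
        ∑ W with typ W = p, φ u W := by
      intro u
      rw [mul_eq]
      exact (Finset.sum_fiberwise _ _ _).symm
    rw [Finset.sum_congr rfl fun u _ => this u, Finset.sum_comm, Fintype.sum_prod_type]
    rw [Finset.sum_congr rfl fun A1 _ => Finset.sum_congr rfl fun B1 _ => h1 A1 B1]
    simp only [← Finset.mul_sum]
    rw [← mul_assoc, inv_mul_cancel₀, one_mul]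
    exact_mod_cast Fintype.card_ne_zero
  rw [h2, sum_subtype_dite]
  refine Finset.sum_congr rfl fun A1 _ => ?_
  by_cases hA : A1 ≤ A1.comap A.x
  swap
  · rw [dif_neg hA]
    refine Finset.sum_eq_zero fun B1 _ => ?_
    rw [Finset.sum_eq_zero, mul_zero]
    intro u _
    exact dif_neg fun hs => hA ((stab_prod_iff A B u A1 B1).1 hs).1
  rw [dif_pos hA, sum_subtype_dite]
  refine Finset.sum_congr rfl fun B1 _ => ?_
  by_cases hB : B1 ≤ B1.comap B.x
  swap
  · rw [dif_neg hB]
    rw [Finset.sum_eq_zero, mul_zero]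
    intro u _
    exact dif_neg fun hs => hB ((stab_prod_iff A B u A1 B1).1 hs).2.1
  rw [dif_pos hB]
  have h3 : ∑ u, φ u (A1.prod B1) = ∑ u : Submodule.compatibleMaps B1 A1, φ u.1 (A1.prod B1) := by
    rw [← Finset.sum_subtype (Finset.univ.filter fun u => u ∈ Submodule.compatibleMaps B1 A1)
      (by simp) (fun u => φ u (A1.prod B1)), Finset.sum_filter_of_ne]
    intro u _ hu
    by_contra hc
    exact hu (dif_neg fun hs => hc ((stab_prod_iff A B u A1 B1).1 hs).2.2)
  rw [h3]
  have h4 := avg_prod (fun p : (B1 →ₗ[F] A1) × ((B.V ⧸ B1) →ₗ[F] (A.V ⧸ A1)) =>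
    h ((A.sub ⟨A1, hA⟩).ext (B.sub ⟨B1, hB⟩) p.1) ((A.quo ⟨A1, hA⟩).ext (B.quo ⟨B1, hB⟩) p.2))
  rw [← avg_surj (compatPair A1 B1) (compatPair_surj A1 B1)] at h4
  refine Eq.trans ?_ h4
  change avg _ = avg _
  exact avg_congr fun u => Hx_prod hh A B ⟨A1, hA⟩ ⟨B1, hB⟩ u

end obj
end HCPaper

namespace HCPaper
open scoped Classical

section frob
open Polynomial
variable {F : Type} [Field F]

theorem frob1 (q : F[X]) (hq : q ≠ 0) : ∃ L : F[X] →ₗ[F] F,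
    (∀ a, q ∣ a → L a = 0) ∧ ∀ r, (∀ s, L (r * s) = 0) → q ∣ r := by
  have hm : (normalize q).Monic := monic_normalize hq
  have hdvd : ∀ a, q ∣ a ↔ normalize q ∣ a := fun a => normalize_dvd_iff.symm
  generalize normalize q = p at hm hdvd
  refine ⟨(lcoeff F (p.natDegree - 1)) ∘ₗ modByMonicHom p, ?_, ?_⟩
  · intro a ha
    have : a %ₘ p = 0 := (modByMonic_eq_zero_iff_dvd hm).2 ((hdvd a).1 ha)
    simp [modByMonicHom, this]
  · intro r hr
    rw [hdvd, ← modByMonic_eq_zero_iff_dvd hm]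
    by_contra hne
    have hp1 : p ≠ 1 := by
      rintro rfl
      exact hne (modByMonic_one r)
    have hlt : (r %ₘ p).natDegree < p.natDegree := natDegree_modByMonic_lt r hm hp1
    have h1 := hr (X ^ (p.natDegree - 1 - (r %ₘ p).natDegree))
    have h2 : (r * X ^ (p.natDegree - 1 - (r %ₘ p).natDegree)) %ₘ p
        = (r %ₘ p) * X ^ (p.natDegree - 1 - (r %ₘ p).natDegree) := by
      have h3 : (r * X ^ (p.natDegree - 1 - (r %ₘ p).natDegree)) %ₘ p
          = ((r %ₘ p) * X ^ (p.natDegree - 1 - (r %ₘ p).natDegree)) %ₘ p := by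
        rw [← sub_eq_zero, ← sub_modByMonic, modByMonic_eq_zero_iff_dvd hm, ← sub_mul]
        refine Dvd.dvd.mul_right ?_ _
        rw [modByMonic_eq_sub_mul_div]
        simp
      rw [h3, modByMonic_eq_self_iff hm, degree_eq_natDegree hm.ne_zero]
      rw [← natDegree_lt_iff_degree_lt (by simpa using hne)]
      rw [natDegree_mul_X_pow _ hne]
      omega
    change ((r * X ^ (p.natDegree - 1 - (r %ₘ p).natDegree)) %ₘ p).coeff _ = 0 at h1
    rw [h2, coeff_mul_X_pow', if_pos (by omega)] at h1
    have h4 : p.natDegree - 1 - (p.natDegree - 1 - (r %ₘ p).natDegree) = (r %ₘ p).natDegree := by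
      omega
    rw [h4] at h1
    exact hne (leadingCoeff_eq_zero.1 h1)

theorem frob2 (q : F[X]) (hq : q ≠ 0) :
    ∃ P : (F[X] ⧸ Submodule.span F[X] {q}) → (F[X] ⧸ Submodule.span F[X] {q}) → F,
      (∀ a a' b, P (a + a') b = P a b + P a' b) ∧ (∀ a b b', P a (b + b') = P a b + P a b') ∧
      (∀ (c : F) a b, P (C c • a) b = c * P a b) ∧ (∀ (c : F) a b, P a (C c • b) = c * P a b) ∧
      (∀ a b, P ((X : F[X]) • a) b = P a ((X : F[X]) • b)) ∧ (∀ a, (∀ b, P a b = 0) → a = 0) := by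
  obtain ⟨L, hL1, hL2⟩ := frob1 q hq
  set I := Submodule.span F[X] {q} with hI
  have hmem : ∀ r, r ∈ I ↔ q ∣ r := fun r => by
    rw [hI]; exact Ideal.mem_span_singleton
  let P : (F[X] ⧸ I) → (F[X] ⧸ I) → F := fun a b =>
    L (Function.surjInv I.mkQ_surjective a * Function.surjInv I.mkQ_surjective b)
  have hP : ∀ r s, P (I.mkQ r) (I.mkQ s) = L (r * s) := by
    intro r s
    have h1 : ∀ r, q ∣ Function.surjInv I.mkQ_surjective (I.mkQ r) - r := by
      intro r
      rw [← hmem, ← Submodule.Quotient.eq]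
      exact Function.surjInv_eq I.mkQ_surjective (I.mkQ r)
    change L _ = _
    rw [← sub_eq_zero, ← map_sub]
    apply hL1
    have e : ∀ r' s' : F[X], r' * s' - r * s = (r' - r) * s' + r * (s' - s) := by intros; ring
    rw [e]
    exact dvd_add ((h1 r).mul_right _) ((h1 s).mul_left _)
  have sj := I.mkQ_surjective
  refine ⟨P, ?_, ?_, ?_, ?_, ?_, ?_⟩
  · intro a a' b
    obtain ⟨a, rfl⟩ := sj a; obtain ⟨a', rfl⟩ := sj a'; obtain ⟨b, rfl⟩ := sj b
    rw [← map_add, hP, hP, hP, add_mul, map_add]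
  · intro a b b'
    obtain ⟨a, rfl⟩ := sj a; obtain ⟨b', rfl⟩ := sj b'; obtain ⟨b, rfl⟩ := sj b
    rw [← map_add, hP, hP, hP, mul_add, map_add]
  · intro c a b
    obtain ⟨a, rfl⟩ := sj a; obtain ⟨b, rfl⟩ := sj b
    rw [← map_smul, hP, hP, smul_eq_mul, mul_assoc, ← smul_eq_C_mul, map_smul, smul_eq_mul]
  · intro c a b
    obtain ⟨a, rfl⟩ := sj a; obtain ⟨b, rfl⟩ := sj b
    rw [← map_smul, hP, hP, smul_eq_mul, mul_left_comm, ← smul_eq_C_mul, map_smul, smul_eq_mul]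
  · intro a b
    obtain ⟨a, rfl⟩ := sj a; obtain ⟨b, rfl⟩ := sj b
    rw [← map_smul, ← map_smul, hP, hP, smul_eq_mul, smul_eq_mul]
    congr 1; ring
  · intro a h
    obtain ⟨a, rfl⟩ := sj a
    rw [Submodule.mkQ_apply, Submodule.Quotient.mk_eq_zero, hmem]
    apply hL2
    intro s
    rw [← hP, h]

theorem exists_form {V : Type} [AddCommGroup V] [Module F V] [FiniteDimensional F V]
    (x : V →ₗ[F] V) : ∃ B : V →ₗ[F] V →ₗ[F] F, (∀ v w, B (x v) w = B v (x w)) ∧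
      Function.Injective B := by
  let M := Module.AEval' x
  have htors : Module.IsTorsion F[X] M := by
    intro m
    have hne : minpoly F x ≠ 0 := minpoly.ne_zero (Algebra.IsIntegral.isIntegral x)
    refine ⟨⟨minpoly F x, mem_nonZeroDivisors_of_ne_zero hne⟩, ?_⟩
    change minpoly F x • m = 0
    obtain ⟨v, rfl⟩ := (Module.AEval'.of x).surjective m
    rw [← Module.AEval.of_aeval_smul, minpoly.aeval]
    simp
  obtain ⟨ι, _, p, hp, e, ⟨E⟩⟩ := Module.equiv_directSum_of_isTorsion htors
  choose P h1 h2 h3 h4 h5 h6 using fun i => frob2 (p i ^ e i) (pow_ne_zero _ (hp i).ne_zero)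
  let co : V → ∀ i, F[X] ⧸ Submodule.span F[X] {p i ^ e i} := fun v i =>
    E (Module.AEval'.of x v) i
  have co_add : ∀ v w i, co (v + w) i = co v i + co w i := by
    intro v w i
    change E (Module.AEval'.of x (v + w)) i = _
    rw [map_add, map_add]; rfl
  have co_smul : ∀ (c : F) v i, co (c • v) i = C c • co v i := by
    intro c v i
    change E (Module.AEval'.of x (c • v)) i = _
    rw [map_smul, ← Module.AEval.C_smul, map_smul]; rfl
  have co_x : ∀ v i, co (x v) i = (X : F[X]) • co v i := by
    intro v i
    change E (Module.AEval'.of x (x v)) i = _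
    rw [← Module.AEval'.X_smul_of, map_smul]; rfl
  let B : V →ₗ[F] V →ₗ[F] F := LinearMap.mk₂ F (fun v w => ∑ i, P i (co v i) (co w i))
    (by intro v v' w; simp only [co_add, h1, Finset.sum_add_distrib])
    (by intro c v w; simp only [co_smul, h3, smul_eq_mul, Finset.mul_sum])
    (by intro v w w'; simp only [co_add, h2, Finset.sum_add_distrib])
    (by intro c v w; simp only [co_smul, h4, smul_eq_mul, Finset.mul_sum])
  have hB : ∀ v w, B v w = ∑ i, P i (co v i) (co w i) := fun v w => rfl
  refine ⟨B, ?_, ?_⟩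
  · intro v w
    rw [hB, hB]
    simp only [co_x, h5]
  · rw [injective_iff_map_eq_zero]
    intro v hv
    have hz : ∀ i, co v i = 0 := by
      intro i
      apply h6
      intro b
      obtain ⟨m, hm⟩ := E.surjective (DirectSum.lof F[X] ι _ i b)
      obtain ⟨w, rfl⟩ := (Module.AEval'.of x).surjective m
      have hw := LinearMap.congr_fun hv w
      rw [hB, Finset.sum_eq_single i] at hw
      · have : co w i = b := by
          change E (Module.AEval'.of x w) i = b
          rw [hm]; exact DirectSum.lof_apply _ _ _
        rw [this] at hw
        exact hw
      · intro j _ hj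
        have : co w j = 0 := by
          change E (Module.AEval'.of x w) j = 0
          rw [hm]
          exact DirectSum.of_eq_of_ne (β := fun i => F[X] ⧸ Submodule.span F[X] {p i ^ e i})
            _ _ _ hj
        rw [this]
        have := h2 j (co v j) 0 0
        simpa using this
      · simp
    have : E (Module.AEval'.of x v) = 0 := by
      ext i
      exact hz i
    simpa using this

end frob

section obj
variable {F : Type} [Field F] [Finite F]

/-- the dual object -/
def Obj.dual (A : Obj F) : Obj F := ⟨A.V →ₗ[F] F, LinearMap.dualMap A.x⟩

theorem dual_finrank (A : Obj F) : Module.finrank F A.V = Module.finrank F (A.V →ₗ[F] F) :=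
  (Subspace.dual_finrank_eq (K := F) (V := A.V)).symm

theorem selfdual (A : Obj F) : Iso A A.dual := by
  obtain ⟨B, h1, h2⟩ := exists_form A.x
  refine ⟨B.linearEquivOfInjective h2 (dual_finrank A), fun v => ?_⟩
  exact LinearMap.ext fun w => h1 v w

theorem iso_dual_ext (A B : Obj F) (u : B.V →ₗ[F] A.V) :
    Iso (A.ext B u).dual (B.dual.ext A.dual (LinearMap.dualMap u)) := by
  let T : ((A.V × B.V) →ₗ[F] F) →ₗ[F] (B.V →ₗ[F] F) × (A.V →ₗ[F] F) :=
    LinearMap.prod (LinearMap.dualMap (LinearMap.inr F A.V B.V))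
      (LinearMap.dualMap (LinearMap.inl F A.V B.V))
  refine ⟨LinearEquiv.ofBijective T ⟨?_, ?_⟩, fun φ => ?_⟩
  · intro φ ψ h
    have hl := congrArg Prod.snd h
    have hr := congrArg Prod.fst h
    exact LinearMap.prod_ext hl hr
  · rintro ⟨φ, ψ⟩
    refine ⟨LinearMap.coprod ψ φ, Prod.ext ?_ ?_⟩
    · exact LinearMap.coprod_inr _ _
    · exact LinearMap.coprod_inl _ _
  · change (A.V × B.V) →ₗ[F] F at φ
    refine Prod.ext ?_ ?_
    · apply LinearMap.ext
      intro b
      change φ (A.x 0 + u b, B.x b) = φ (0, B.x b) + φ (u b, 0)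
      rw [← map_add]; simp
    · apply LinearMap.ext
      intro a
      change φ (A.x a + u 0, B.x 0) = φ (A.x a, 0)
      simp

/-- cocommutativity -/
theorem cop_comm {f : Obj F → ℂ} (hf : Cls f) (A B : Obj F) : cop f A B = cop f B A := by
  rw [cop_cls hf B B.dual A A.dual (selfdual B) (selfdual A)]
  unfold cop
  have hbij : Function.Bijective (fun u : B.V →ₗ[F] A.V =>
      (LinearMap.dualMap u : (A.V →ₗ[F] F) →ₗ[F] (B.V →ₗ[F] F))) := by
    have hinj : Function.Injective (Module.Dual.transpose (R := F) (M := B.V) (M' := A.V)) := by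
      intro u v h
      ext b
      have h1 : ∀ φ : A.V →ₗ[F] F, φ (u b) = φ (v b) := fun φ =>
        LinearMap.congr_fun (LinearMap.congr_fun h φ) b
      rw [← sub_eq_zero]
      rw [← Module.forall_dual_apply_eq_zero_iff F]
      intro φ
      rw [map_sub, h1 φ, sub_self]
    have hfin : Module.finrank F (B.V →ₗ[F] A.V) =
        Module.finrank F ((A.V →ₗ[F] F) →ₗ[F] (B.V →ₗ[F] F)) := by
      rw [Module.finrank_linearMap F F B.V A.V,
        Module.finrank_linearMap F F (A.V →ₗ[F] F) (B.V →ₗ[F] F), ← dual_finrank A,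
        ← dual_finrank B, mul_comm]
    let T : (B.V →ₗ[F] A.V) →ₗ[F] ((A.V →ₗ[F] F) →ₗ[F] (B.V →ₗ[F] F)) :=
      Module.Dual.transpose (R := F) (M := B.V) (M' := A.V)
    exact ⟨hinj, (LinearMap.injective_iff_surjective_of_finrank_eq_finrank (K := F) (V := B.V →ₗ[F] A.V)
      (V₂ := (A.V →ₗ[F] F) →ₗ[F] (B.V →ₗ[F] F)) hfin (f := T)).1 hinj⟩
  refine Eq.trans ?_ (avg_equiv (Equiv.ofBijective _ hbij)
    (fun u => f (B.dual.ext A.dual u)))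
  exact avg_congr fun u => hf _ _ ((selfdual _).trans (iso_dual_ext A B u))

theorem cop_comm' {f : Obj F → ℂ} (hf : Cls f) (B : Obj F) : (fun A => cop f A B) = cop f B :=
  funext fun A => cop_comm hf A B

def annStab (A : Obj F) (W : Stab A) : Stab A.dual :=
  ⟨(Submodule.dualAnnihilator W.1 : Submodule F (Module.Dual F A.V)), by
    intro φ hφ
    change LinearMap.dualMap A.x φ ∈ Submodule.dualAnnihilator W.1
    rw [Submodule.mem_dualAnnihilator]
    intro w hw
    exact (Submodule.mem_dualAnnihilator φ).1 hφ _ (W.2 hw)⟩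

theorem annStab_bij (A : Obj F) : Function.Bijective (annStab A) := by
  constructor
  · intro W W' h
    exact Subtype.ext (Subspace.dualAnnihilator_inj.1 (congrArg Subtype.val h))
  · rintro ⟨U, hU⟩
    change Submodule F (Module.Dual F A.V) at U
    refine ⟨⟨U.dualCoannihilator, ?_⟩, Subtype.ext ?_⟩
    · intro v hv
      change A.x v ∈ U.dualCoannihilator
      rw [Submodule.mem_dualCoannihilator] at hv ⊢
      intro φ hφ
      exact hv _ (hU hφ)
    · exact Subspace.dualCoannihilator_dualAnnihilator_eq

/-- commutativity -/
theorem mul_comm' {h : Obj F → Obj F → ℂ} (hh : Cls2 h) (A : Obj F) :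
    mul h A = mul (fun P Q => h Q P) A := by
  rw [mul_cls hh A A.dual (selfdual A)]
  unfold mul
  rw [← (annStab_bij A).sum_comp]
  refine Finset.sum_congr rfl fun W _ => hh _ _ _ _ ?_ ?_
  · refine Iso.symm ((selfdual (A.quo W)).trans (iso_sub_of _ _ _ (LinearMap.dualMap W.1.mkQ) ?_ ?_ ?_))
    · exact LinearMap.dualMap_injective_of_surjective W.1.mkQ_surjective
    · intro φ
      have := Submodule.range_dualMap_mkQ_eq W.1
      change φ ∈ Submodule.dualAnnihilator W.1 ↔ _
      rw [← this]; rfl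
    · intro φ
      rfl
  · refine Iso.trans (iso_quo_of _ (A.sub W).dual _ (LinearMap.dualMap W.1.subtype) ?_ ?_ ?_)
      (selfdual (A.sub W)).symm
    · exact LinearMap.dualMap_surjective_of_injective W.1.injective_subtype
    · intro φ
      change φ ∈ Submodule.dualAnnihilator W.1 ↔ _
      refine (Submodule.mem_dualAnnihilator (W := W.1) (φ : Module.Dual F A.V)).trans ?_
      constructor
      · intro h'
        apply LinearMap.ext
        intro w
        exact h' w.1 w.2
      · intro h' w hw
        exact LinearMap.congr_fun h' ⟨w, hw⟩
    · intro φ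
      rfl

end obj
end HCPaper

namespace HCPaper
open scoped Classical

section dual
variable {F : Type} [Field F]

def botStab (A : Obj F) : Stab A := ⟨⊥, bot_le⟩

theorem dim_sub_eq_zero (A : Obj F) (W : Stab A) : (A.sub W).dim = 0 ↔ W = botStab A := by
  have : (A.sub W).dim = 0 ↔ W.1 = ⊥ := Submodule.finrank_eq_zero (R := F) (S := W.1)
  rw [this]
  exact ⟨fun h => Subtype.ext h, fun h => congrArg Subtype.val h⟩

theorem dim_sub_pos {A : Obj F} {W : Stab A} (h : W ≠ botStab A) : 0 < (A.sub W).dim :=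
  Nat.pos_of_ne_zero fun h' => h ((dim_sub_eq_zero A W).1 h')

theorem dim_quo_lt {A : Obj F} {W : Stab A} (h : W ≠ botStab A) : (A.quo W).dim < A.dim := by
  have := dim_sub_quo A W
  have := dim_sub_pos h
  omega

theorem dim_sub_bot (A : Obj F) : (A.sub (botStab A)).dim = 0 := (dim_sub_eq_zero _ _).2 rfl

theorem iso_quo_bot (A : Obj F) : Iso (A.quo (botStab A)) A :=
  iso_quo_of A A (botStab A) LinearMap.id Function.surjective_id
    (fun v => by simp [botStab]) (fun v => rfl)

theorem subsingleton_of_dim {A : Obj F} (h : A.dim = 0) : Subsingleton A.V :=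
  Module.finrank_zero_iff.1 h

theorem iso_zero_ext (A B : Obj F) (h : A.dim = 0) (u : B.V →ₗ[F] A.V) : Iso (A.ext B u) B := by
  haveI := subsingleton_of_dim h
  let T : (A.V × B.V) →ₗ[F] B.V := LinearMap.snd F A.V B.V
  refine ⟨LinearEquiv.ofBijective T ⟨?_, ?_⟩, fun v => rfl⟩
  · rintro ⟨a, b⟩ ⟨a', b'⟩ hh
    exact Prod.ext (Subsingleton.elim _ _) hh
  · intro b
    exact ⟨(0, b), rfl⟩

theorem cop_zero {f : Obj F → ℂ} (hf : Cls f) {A : Obj F} (h : A.dim = 0) : cop f A = f := by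
  funext B
  unfold cop
  rw [avg_congr fun u => hf _ _ (iso_zero_ext A B h u), avg_const]

/-- duality -/
noncomputable def D (A : Obj F) (f : Obj F → ℂ) : ℂ :=
  if A.dim = 0 then f A else
    ∑ W : Stab A, if h : W = botStab A then 0 else
      (-1) ^ ((A.sub W).dim + 1) * D (A.quo W) (cop f (A.sub W))
termination_by A.dim
decreasing_by exact dim_quo_lt h

theorem D_zero {A : Obj F} (h : A.dim = 0) (f : Obj F → ℂ) : D A f = f A := by
  rw [D, if_pos h]

theorem D_pos {A : Obj F} (h : A.dim ≠ 0) (f : Obj F → ℂ) : D A f =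
    ∑ W : Stab A, if W = botStab A then 0 else
      (-1) ^ ((A.sub W).dim + 1) * D (A.quo W) (cop f (A.sub W)) := by
  rw [D, if_neg h]
  simp

/-- functionals supported in dimension n -/
def S (F : Type) [Field F] (n : ℕ) : Submodule ℂ ((Obj F → ℂ) → ℂ) :=
  Submodule.span ℂ {φ | ∃ O : Obj F, O.dim = n ∧ φ = fun f => f O}

theorem S_ev (O : Obj F) : (fun f : Obj F → ℂ => f O) ∈ S F O.dim :=
  Submodule.subset_span ⟨O, rfl, rfl⟩

theorem S_cop {n : ℕ} {φ : (Obj F → ℂ) → ℂ} (hφ : φ ∈ S F n) (A : Obj F) :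
    (fun f => φ (cop f A)) ∈ S F (A.dim + n) := by
  induction hφ using Submodule.span_induction with
  | mem φ h =>
    obtain ⟨O, rfl, rfl⟩ := h
    have : (fun f : Obj F → ℂ => cop f A O) =
        (Fintype.card (O.V →ₗ[F] A.V) : ℂ)⁻¹ • ∑ u : O.V →ₗ[F] A.V,
          (fun f : Obj F → ℂ => f (A.ext O u)) := by
      funext f
      simp [cop, avg]
    rw [this]
    refine Submodule.smul_mem _ _ (Submodule.sum_mem _ fun u _ => ?_)
    rw [← dim_ext A O u]
    exact S_ev _
  | zero => exact Submodule.zero_mem _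
  | add φ ψ _ _ h1 h2 => exact Submodule.add_mem _ h1 h2
  | smul c φ _ h => exact Submodule.smul_mem _ c h

theorem D_mem (A : Obj F) : D A ∈ S F A.dim := by
  by_cases h : A.dim = 0
  · have : D A = fun f => f A := funext fun f => D_zero h f
    rw [this]
    exact S_ev A
  · have : D A = ∑ W : Stab A, (if W = botStab A then (0 : (Obj F → ℂ) → ℂ) else
      ((-1 : ℂ) ^ ((A.sub W).dim + 1)) • (fun f : Obj F → ℂ => D (A.quo W) (cop f (A.sub W)))) := by
      funext f
      rw [D_pos h, Finset.sum_apply]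
      refine Finset.sum_congr rfl fun W _ => ?_
      split_ifs <;> simp
    rw [this]
    refine Submodule.sum_mem _ fun W _ => ?_
    split_ifs with hW
    · exact Submodule.zero_mem _
    · refine Submodule.smul_mem _ _ ?_
      have ih := D_mem (A.quo W)
      rw [← dim_sub_quo A W]
      exact S_cop ih _
termination_by A.dim
decreasing_by exact dim_quo_lt hW

theorem S_local {n : ℕ} {φ : (Obj F → ℂ) → ℂ} (hφ : φ ∈ S F n) {f g : Obj F → ℂ}
    (h : ∀ O : Obj F, O.dim = n → f O = g O) : φ f = φ g := by
  induction hφ using Submodule.span_induction with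
  | mem φ h' =>
    obtain ⟨O, hO, rfl⟩ := h'
    exact h O hO
  | zero => rfl
  | add φ ψ _ _ h1 h2 => simp [h1, h2]
  | smul c φ _ h => simp [h]

theorem S_add {n : ℕ} {φ : (Obj F → ℂ) → ℂ} (hφ : φ ∈ S F n) (f g : Obj F → ℂ) :
    φ (fun O => f O + g O) = φ f + φ g := by
  induction hφ using Submodule.span_induction with
  | mem φ h' =>
    obtain ⟨O, hO, rfl⟩ := h'
    rfl
  | zero => simp
  | add φ ψ _ _ h1 h2 => simp only [Pi.add_apply, h1, h2]; ring
  | smul c φ _ h => simp only [Pi.smul_apply, h, smul_add]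

theorem S_mul {n : ℕ} {φ : (Obj F → ℂ) → ℂ} (hφ : φ ∈ S F n) (c : ℂ) (f : Obj F → ℂ) :
    φ (fun O => c * f O) = c * φ f := by
  induction hφ using Submodule.span_induction with
  | mem φ h' =>
    obtain ⟨O, hO, rfl⟩ := h'
    rfl
  | zero => simp
  | add φ ψ _ _ h1 h2 => simp only [Pi.add_apply, h1, h2]; ring
  | smul c φ _ h => simp only [Pi.smul_apply, h, smul_eq_mul]; ring

theorem S_zero {n : ℕ} {φ : (Obj F → ℂ) → ℂ} (hφ : φ ∈ S F n) : φ (fun _ => 0) = 0 := by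
  have := S_mul hφ 0 (fun _ => 0)
  simpa using this

theorem S_comm {n m : ℕ} {φ ψ : (Obj F → ℂ) → ℂ} (hφ : φ ∈ S F n) (hψ : ψ ∈ S F m)
    (h : Obj F → Obj F → ℂ) :
    φ (fun A => ψ (fun B => h A B)) = ψ (fun B => φ (fun A => h A B)) := by
  induction hφ using Submodule.span_induction with
  | mem φ h' =>
    obtain ⟨O, hO, rfl⟩ := h'
    rfl
  | zero => exact (S_zero hψ).symm
  | add φ φ' _ _ h1 h2 => simp only [Pi.add_apply, h1, h2]; exact (S_add hψ _ _).symm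
  | smul c φ _ h => simp only [Pi.smul_apply, h, smul_eq_mul]; exact (S_mul hψ _ _).symm

theorem S_sum {n : ℕ} {φ : (Obj F → ℂ) → ℂ} (hφ : φ ∈ S F n) {ι : Type} (s : Finset ι)
    (f : ι → Obj F → ℂ) : φ (fun O => ∑ i ∈ s, f i O) = ∑ i ∈ s, φ (f i) := by
  induction s using Finset.induction_on with
  | empty => simpa using S_zero hφ
  | insert a s ha ih =>
    simp only [Finset.sum_insert ha]
    rw [S_add hφ, ih]

theorem S_avg {n : ℕ} {φ : (Obj F → ℂ) → ℂ} (hφ : φ ∈ S F n) {ι : Type} [Fintype ι]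
    (f : ι → Obj F → ℂ) : φ (fun O => avg fun i => f i O) = avg fun i => φ (f i) := by
  unfold avg
  rw [S_mul hφ, S_sum hφ]

theorem D_iso {f : Obj F → ℂ} (hf : Cls f) {A B : Obj F} (i : Iso A B) : D A f = D B f := by
  by_cases h : A.dim = 0
  · rw [D_zero h, D_zero (by rw [← i.dim]; exact h)]
    exact hf _ _ i
  · rw [D_pos h, D_pos (by rw [← i.dim]; exact h)]
    obtain ⟨e, he⟩ := i
    rw [← Equiv.sum_comp (stabEquiv e he)]
    refine Finset.sum_congr rfl fun W _ => ?_
    have i1 : Iso (A.sub W) (B.sub (stabEquiv e he W)) := iso_sub e he _ _ rfl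
    have i2 : Iso (A.quo W) (B.quo (stabEquiv e he W)) := iso_quo e he _ _ rfl
    have hb : stabEquiv e he W = botStab B ↔ W = botStab A := by
      rw [← dim_sub_eq_zero, ← dim_sub_eq_zero, i1.dim]
    simp only [hb]
    split_ifs with hW
    · rfl
    · have hc : cop f (A.sub W) = cop f (B.sub (stabEquiv e he W)) :=
        funext fun Q => (cop_cls hf).left Q _ _ i1
      rw [i1.dim, ← hc]
      rw [D_iso ((cop_cls hf).right _) i2]
termination_by A.dim
decreasing_by exact dim_quo_lt hW

theorem D_cls {f : Obj F → ℂ} (hf : Cls f) : Cls (fun P => D P f) := fun _ _ i => D_iso hf i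

theorem D_cls2 {k : Obj F → Obj F → ℂ} (hk : Cls2 k) : Cls2 (fun P Q => D Q (k P)) := by
  intro A A' B B' i j
  have : k A = k A' := funext fun Q => hk.left Q _ _ i
  change D B (k A) = D B' (k A')
  rw [this]
  exact D_iso (hk.right _) j

/-- the signed integrand -/
noncomputable def Th (f : Obj F → ℂ) (P Q : Obj F) : ℂ := (-1) ^ P.dim * D Q (cop f P)

theorem Th_cls {f : Obj F → ℂ} (hf : Cls f) : Cls2 (Th f) := by
  intro A A' B B' i j
  unfold Th
  rw [i.dim]
  congr 1
  exact D_cls2 (cop_cls hf) _ _ _ _ i j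

theorem T_eq {f : Obj F → ℂ} (hf : Cls f) (A : Obj F) :
    mul (Th f) A = if A.dim = 0 then f A else 0 := by
  have hbot : Th f (A.sub (botStab A)) (A.quo (botStab A)) = D A f := by
    unfold Th
    rw [dim_sub_bot, cop_zero hf (dim_sub_bot A), pow_zero, one_mul]
    exact D_iso hf (iso_quo_bot A)
  unfold mul
  rw [← Finset.add_sum_erase _ _ (Finset.mem_univ (botStab A)), hbot]
  split_ifs with h
  · rw [D_zero h, Finset.sum_eq_zero, add_zero]
    intro W hW
    exfalso
    have := dim_sub_pos (Finset.ne_of_mem_erase hW)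
    have := dim_sub_quo A W
    omega
  · rw [D_pos h, ← Finset.add_sum_erase _ _ (Finset.mem_univ (botStab A)), if_pos rfl, zero_add,
      ← Finset.sum_add_distrib]
    apply Finset.sum_eq_zero
    intro W hW
    rw [if_neg (Finset.ne_of_mem_erase hW)]
    unfold Th
    ring

end dual

section dual2
variable {F : Type} [Field F] [Finite F]

theorem fourfold {f : Obj F → ℂ} (hf : Cls f) (A1 B1 P Q : Obj F) :
    cop (fun R => cop (cop f R) P Q) A1 B1 = cop (fun R => cop (cop f R) B1 Q) A1 P := by
  have hQ : Cls (fun S => cop f S Q) := (cop_cls hf).left Q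
  simp only [← cop_assoc hf]
  rw [cop_assoc hQ, cop_assoc hQ]
  exact cop_comm ((cop_cls hQ).right _) _ _

theorem D_cop {f : Obj F → ℂ} (hf : Cls f) (A B : Obj F) :
    cop (fun P => D P f) A B = D A (fun P => D B (fun Q => cop f P Q)) := by
  induction hn : A.dim + B.dim using Nat.strong_induction_on generalizing f A B with
  | _ n ih =>
  by_cases h0 : A.dim + B.dim = 0
  · rw [D_zero (by omega), D_zero (by omega)]
    unfold cop
    exact avg_congr fun u => D_zero (by rw [dim_ext, h0]) _
  let L : Stab A → Stab B → ℂ := fun A1 B1 =>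
    cop (fun R => cop (fun O => D O (cop f R)) (A.quo A1) (B.quo B1)) (A.sub A1) (B.sub B1)
  let R : Stab A → Stab B → ℂ := fun A1 B1 =>
    D (A.quo A1) (fun P => D (B.quo B1) (fun Q =>
      cop (fun R => cop (cop f R) P Q) (A.sub A1) (B.sub B1)))
  let sg : Stab A → Stab B → ℂ := fun A1 B1 => (-1) ^ ((A.sub A1).dim + (B.sub B1).dim)
  have hL : ∑ A1, ∑ B1, sg A1 B1 * L A1 B1 = 0 := by
    have h1 := mackey (Th_cls hf) A B
    have h2 : cop (mul (Th f)) A B = 0 := by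
      unfold cop
      rw [avg_congr (ψ := fun _ => 0), avg_const]
      intro u
      rw [T_eq hf, if_neg (by rw [dim_ext]; exact h0)]
    rw [h2] at h1
    rw [h1]
    refine Finset.sum_congr rfl fun A1 _ => Finset.sum_congr rfl fun B1 _ => ?_
    simp only [L, sg, Th, dim_ext, avg_mul]
    rfl
  have hR : ∑ A1, ∑ B1, sg A1 B1 * R A1 B1 = 0 := by
    have hc : Cls2 (cop f) := cop_cls hf
    have hg : Cls (fun O => mul (Th (cop f O)) B) := by
      intro O O' i
      have : cop f O = cop f O' := funext fun Q => hc.left Q _ _ i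
      simp only [this]
    have h1 : mul (Th (fun O => mul (Th (cop f O)) B)) A = 0 := by
      rw [T_eq hg]
      split_ifs with hA
      · rw [T_eq (hc.right _), if_neg (by omega)]
      · rfl
    rw [← h1]
    unfold mul
    refine Finset.sum_congr rfl fun A1 _ => ?_
    have h3 : Th (fun O => ∑ W : Stab B, Th (cop f O) (B.sub W) (B.quo W)) (A.sub A1) (A.quo A1)
        = (-1) ^ (A.sub A1).dim * D (A.quo A1) (fun P => ∑ W : Stab B, avg fun u =>
            Th (cop f ((A.sub A1).ext P u)) (B.sub W) (B.quo W)) := by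
      unfold Th
      congr 2
      funext P
      unfold cop
      rw [avg_sum]
    rw [h3, S_sum (D_mem _), Finset.mul_sum]
    refine Finset.sum_congr rfl fun B1 _ => ?_
    have h4 : (fun P => avg fun u => Th (cop f ((A.sub A1).ext P u)) (B.sub B1) (B.quo B1)) =
        fun P => (-1) ^ (B.sub B1).dim * D (B.quo B1) (fun Q =>
          cop (fun R => cop (cop f R) P Q) (A.sub A1) (B.sub B1)) := by
      funext P
      rw [show (fun Q => cop (fun R => cop (cop f R) P Q) (A.sub A1) (B.sub B1)) =
        (fun Q => cop (fun R => cop (cop f R) (B.sub B1) Q) (A.sub A1) P) from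
        funext fun Q => fourfold hf _ _ _ _]
      unfold Th
      rw [avg_mul, ← S_avg (D_mem _)]
      rfl
    rw [h4, S_mul (D_mem _), ← mul_assoc, ← pow_add]
  have heq : ∀ A1 B1, ¬ (A1 = botStab A ∧ B1 = botStab B) → L A1 B1 = R A1 B1 := by
    intro A1 B1 hne
    have hlt : (A.quo A1).dim + (B.quo B1).dim < n := by
      have h1 := dim_sub_quo A A1
      have h2 := dim_sub_quo B B1
      have h3 := dim_sub_eq_zero A A1
      have h4 := dim_sub_eq_zero B B1
      by_contra hcon
      exact hne ⟨h3.1 (by omega), h4.1 (by omega)⟩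
    have : ∀ O, cop (fun P => D P (cop f O)) (A.quo A1) (B.quo B1) =
        D (A.quo A1) (fun P => D (B.quo B1) (fun Q => cop (cop f O) P Q)) := fun O =>
      ih _ hlt ((cop_cls hf).right O) _ _ rfl
    simp only [L, R, this]
    conv_lhs => unfold cop
    rw [← S_avg (D_mem _)]
    congr 1
    funext P
    rw [← S_avg (D_mem _)]
    rfl
  have hbot : L (botStab A) (botStab B) = R (botStab A) (botStab B) := by
    have hd : ∑ A1, ∑ B1, sg A1 B1 * (L A1 B1 - R A1 B1) = 0 := by
      simp only [mul_sub, Finset.sum_sub_distrib, hL, hR, sub_self]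
    rw [Finset.sum_eq_single (botStab A), Finset.sum_eq_single (botStab B)] at hd
    · rcases mul_eq_zero.1 hd with h | h
      · simp [sg] at h
      · exact sub_eq_zero.1 h
    · intro B1 _ hB
      rw [heq _ _ (fun h => hB h.2), sub_self, mul_zero]
    · simp
    · intro A1 _ hA
      refine Finset.sum_eq_zero fun B1 _ => ?_
      rw [heq _ _ (fun h => hA h.1), sub_self, mul_zero]
    · simp
  have z : ∀ u, ((A.sub (botStab A)).ext (B.sub (botStab B)) u).dim = 0 := fun u => by
    rw [dim_ext, dim_sub_bot, dim_sub_bot]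
  have hLb : L (botStab A) (botStab B) = cop (fun P => D P f) A B := by
    simp only [L]
    conv_lhs => unfold cop
    rw [avg_congr (ψ := fun _ => cop (fun P => D P f) A B), avg_const]
    intro u
    have : cop f ((A.sub (botStab A)).ext (B.sub (botStab B)) u) = f := cop_zero hf (z u)
    refine Eq.trans ?_ (cop_cls (D_cls hf) _ _ _ _ (iso_quo_bot A) (iso_quo_bot B))
    change cop (fun O => D O (cop f ((A.sub (botStab A)).ext (B.sub (botStab B)) u)))
      (A.quo (botStab A)) (B.quo (botStab B)) = _
    rw [this]
  have hRb : R (botStab A) (botStab B) = D A (fun P => D B (fun Q => cop f P Q)) := by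
    have : ∀ P Q, cop (fun R => cop (cop f R) P Q) (A.sub (botStab A)) (B.sub (botStab B)) =
        cop f P Q := by
      intro P Q
      conv_lhs => unfold cop
      rw [avg_congr (ψ := fun _ => cop f P Q), avg_const]
      intro u
      have : cop f ((A.sub (botStab A)).ext (B.sub (botStab B)) u) = f := cop_zero hf (z u)
      conv_rhs => rw [← this]
      rfl
    simp only [R, this]
    have e1 : ∀ P, D (B.quo (botStab B)) (fun Q => cop f P Q) = D B (fun Q => cop f P Q) :=
      fun P => D_iso ((cop_cls hf).right P) (iso_quo_bot B)
    simp only [e1]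
    refine D_iso ?_ (iso_quo_bot A)
    exact (D_cls2 (cop_cls hf)).left B
  rw [← hLb, hbot, hRb]

theorem D_D {f : Obj F → ℂ} (hf : Cls f) (A : Obj F) : D A (fun P => D P f) = f A := by
  induction hn : A.dim using Nat.strong_induction_on generalizing f A with
  | _ n ih =>
  by_cases h0 : A.dim = 0
  · rw [D_zero h0, D_zero h0]
  let h : Obj F → Obj F → ℂ := fun P Q => (-1) ^ P.dim * D P (cop f Q)
  have hh : Cls2 h := by
    intro P P' Q Q' i j
    simp only [h]
    rw [i.dim]
    congr 1
    exact D_cls2 (cop_cls hf) _ _ _ _ j i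
  have hz : mul h A = 0 := by
    rw [mul_comm' hh]
    have h1 : mul (fun P Q => h Q P) A = (-1) ^ A.dim * mul (Th f) A := by
      unfold mul
      rw [Finset.mul_sum]
      refine Finset.sum_congr rfl fun W _ => ?_
      simp only [h, Th]
      rw [← dim_sub_quo A W, pow_add, ← mul_assoc]
      congr 1
      have : ((-1 : ℂ) ^ (A.sub W).dim) * ((-1 : ℂ) ^ (A.sub W).dim) = 1 := by
        rw [← mul_pow]; simp
      rw [mul_assoc, mul_left_comm, this, mul_one]
    rw [h1, T_eq hf, if_neg h0, mul_zero]
  unfold mul at hz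
  rw [← Finset.add_sum_erase _ _ (Finset.mem_univ (botStab A))] at hz
  have hb : h (A.sub (botStab A)) (A.quo (botStab A)) = f A := by
    simp only [h]
    rw [dim_sub_bot, pow_zero, one_mul, D_zero (dim_sub_bot A), cop_comm hf,
      cop_zero hf (dim_sub_bot A)]
    exact hf _ _ (iso_quo_bot A)
  rw [hb] at hz
  rw [D_pos h0, ← Finset.add_sum_erase _ _ (Finset.mem_univ (botStab A)), if_pos rfl, zero_add,
    eq_neg_of_add_eq_zero_left hz, ← Finset.sum_neg_distrib]
  refine Finset.sum_congr rfl fun W hW => ?_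
  rw [if_neg (Finset.ne_of_mem_erase hW)]
  have e1 : cop (fun P => D P f) (A.sub W) =
      fun Q => D (A.sub W) (fun P => D Q (cop f P)) := funext fun Q => D_cop hf _ _
  rw [e1, S_comm (D_mem _) (D_mem _)]
  have e2 : ∀ P, D (A.quo W) (fun Q => D Q (cop f P)) = cop f P (A.quo W) := fun P =>
    ih _ (by rw [← hn]; exact dim_quo_lt (Finset.ne_of_mem_erase hW)) ((cop_cls hf).right P) _ rfl
  simp only [e2]
  rw [cop_comm' hf]
  simp only [h]
  ring

end dual2
end HCPaper

namespace HCPaper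
open scoped Classical

set_option linter.unusedSectionVars false
section bridge
variable {F : Type} [Field F] [Fintype F] [DecidableEq F]

/-- object attached to a matrix -/
def mo {n : ℕ} (x : gl F n) : Obj F := ⟨Fin n → F, Matrix.mulVecLin x⟩

theorem dim_mo {n : ℕ} (x : gl F n) : (mo x).dim = n := Module.finrank_fin_fun F

noncomputable def gam {n : ℕ} (g : Matrix.GeneralLinearGroup (Fin n) F) :
    (Fin n → F) ≃ₗ[F] (Fin n → F) :=
  LinearMap.GeneralLinearGroup.generalLinearEquiv F (Fin n → F) (Matrix.GeneralLinearGroup.toLin g)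

theorem gam_apply {n : ℕ} (g : Matrix.GeneralLinearGroup (Fin n) F) (v : Fin n → F) :
    gam g v = (g : Matrix (Fin n) (Fin n) F) *ᵥ v := rfl

theorem gam_mul {n : ℕ} (g h : Matrix.GeneralLinearGroup (Fin n) F) (v : Fin n → F) :
    gam (g * h) v = gam g (gam h v) := by
  simp [gam_apply, Matrix.mulVec_mulVec]

theorem gam_surj {n : ℕ} : Function.Surjective (gam (F := F) (n := n)) := by
  intro e
  obtain ⟨a, ha⟩ := (LinearMap.GeneralLinearGroup.generalLinearEquiv F (Fin n → F)).surjective e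
  obtain ⟨g, hg⟩ := (Matrix.GeneralLinearGroup.toLin (n := Fin n) (R := F)).surjective a
  exact ⟨g, by rw [gam, hg, ha]⟩

theorem gam_inj {n : ℕ} : Function.Injective (gam (F := F) (n := n)) := by
  intro g h e
  exact Matrix.GeneralLinearGroup.toLin.injective
    ((LinearMap.GeneralLinearGroup.generalLinearEquiv F (Fin n → F)).injective e)

theorem gam_conj {n : ℕ} (g : Matrix.GeneralLinearGroup (Fin n) F) (x : gl F n) (v : Fin n → F) :
    gam g (x *ᵥ v) = conjM g x *ᵥ (gam g v) := by
  simp only [gam_apply, conjM, Matrix.mulVec_mulVec]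
  rw [mul_assoc, ← Units.val_mul, inv_mul_cancel]
  simp

theorem iso_conj {n : ℕ} (g : Matrix.GeneralLinearGroup (Fin n) F) (x : gl F n) :
    Iso (mo x) (mo (conjM g x)) := ⟨gam g, fun v => gam_conj g x v⟩

theorem conj_of_iso {n : ℕ} {x y : gl F n} (h : Iso (mo x) (mo y)) :
    ∃ g : Matrix.GeneralLinearGroup (Fin n) F, y = conjM g x := by
  obtain ⟨e, he⟩ := h
  change (Fin n → F) ≃ₗ[F] (Fin n → F) at e
  obtain ⟨g, rfl⟩ := gam_surj e
  refine ⟨g, ?_⟩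
  apply Matrix.mulVec_injective
  funext v
  obtain ⟨w, rfl⟩ := (gam g).surjective v
  rw [← gam_conj]
  exact (he w).symm

theorem exists_mo {n : ℕ} (A : Obj F) (h : A.dim = n) : ∃ x : gl F n, Iso (mo x) A := by
  have e : A.V ≃ₗ[F] (Fin n → F) := LinearEquiv.ofFinrankEq _ _ (by
    rw [Module.finrank_fin_fun]; exact h)
  refine ⟨LinearMap.toMatrix' (e.toLinearMap ∘ₗ A.x ∘ₗ e.symm.toLinearMap), e.symm, fun v => ?_⟩
  refine (congrArg e.symm (LinearMap.toMatrix'_mulVec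
    (e.toLinearMap ∘ₗ A.x ∘ₗ e.symm.toLinearMap) v)).trans ?_
  exact e.symm_apply_apply _

noncomputable def ft {n : ℕ} (f : gl F n → ℂ) (A : Obj F) : ℂ :=
  if h : ∃ x, Iso (mo x) A then f h.choose else 0

theorem ft_eq {n : ℕ} {f : gl F n → ℂ} (hf : Invariant n f) {x : gl F n} {A : Obj F}
    (i : Iso (mo x) A) : ft f A = f x := by
  have h : ∃ x : gl F n, Iso (mo x) A := ⟨x, i⟩
  rw [ft, dif_pos h]
  obtain ⟨g, hg⟩ := conj_of_iso (i.trans h.choose_spec.symm)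
  rw [hg]
  exact hf g x

theorem ft_cls {n : ℕ} {f : gl F n → ℂ} : Cls (ft f) := by
  intro A B i
  have : ∀ x : gl F n, Iso (mo x) A = Iso (mo x) B := fun x =>
    propext ⟨fun h => h.trans i, fun h => h.trans i.symm⟩
  unfold ft
  simp only [this]

theorem inv_of_cls {n : ℕ} {h : Obj F → ℂ} (hh : Cls h) {f : gl F n → ℂ}
    (hf : ∀ x, f x = h (mo x)) : Invariant n f := by
  intro g x
  rw [hf, hf]
  exact hh _ _ (iso_conj g x).symm

theorem castM_rfl {n : ℕ} (x : gl F n) : castM rfl x = x := by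
  ext i j; rfl

theorem iso_cast {m n : ℕ} (h : m = n) (x : gl F m) : Iso (mo (castM h x)) (mo x) := by
  subst h
  rw [castM_rfl]
  exact Iso.refl _

theorem castFun_rfl {n : ℕ} (f : gl F n → ℂ) : castFun rfl f = f := by
  funext x
  simp [castFun, castM_rfl]

theorem ft_cast {m n : ℕ} (h : m = n) (f : gl F m → ℂ) : ft (castFun h f) = ft f := by
  subst h
  rw [castFun_rfl]

theorem inv_cast {m n : ℕ} (h : m = n) {f : gl F m → ℂ} (hf : Invariant m f) :
    Invariant n (castFun h f) := by
  subst h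
  rwa [castFun_rfl]

theorem but_mulVec {k l : ℕ} (x : gl F k) (u : Matrix (Fin k) (Fin l) F) (y : gl F l)
    (a : Fin k → F) (b : Fin l → F) :
    but k l x u y *ᵥ (Sum.elim a b ∘ finSumFinEquiv.symm) =
      Sum.elim (x *ᵥ a + u *ᵥ b) (y *ᵥ b) ∘ finSumFinEquiv.symm := by
  unfold but
  rw [Matrix.reindex_apply, Matrix.submatrix_mulVec_equiv]
  have : (Sum.elim a b ∘ ⇑finSumFinEquiv.symm) ∘ ⇑finSumFinEquiv.symm.symm = Sum.elim a b := by
    funext i; simp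
  rw [this, Matrix.fromBlocks_mulVec]
  simp

/-- splitting vectors -/
def spl (F : Type) [Field F] (k l : ℕ) : ((Fin k → F) × (Fin l → F)) ≃ₗ[F] (Fin (k + l) → F) where
  toFun p := Sum.elim p.1 p.2 ∘ finSumFinEquiv.symm
  invFun v := (fun i => v (finSumFinEquiv (Sum.inl i)), fun j => v (finSumFinEquiv (Sum.inr j)))
  left_inv p := by simp
  right_inv v := by
    funext i
    obtain ⟨s, rfl⟩ := finSumFinEquiv.surjective i
    cases s <;> simp
  map_add' p q := by
    funext i
    obtain ⟨s, rfl⟩ := finSumFinEquiv.surjective i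
    cases s <;> simp
  map_smul' c p := by
    funext i
    obtain ⟨s, rfl⟩ := finSumFinEquiv.surjective i
    cases s <;> simp

theorem iso_but {k l : ℕ} (x : gl F k) (u : Matrix (Fin k) (Fin l) F) (y : gl F l) :
    Iso (mo (but k l x u y)) ((mo x).ext (mo y) (Matrix.mulVecLin u)) := by
  apply Iso.symm
  exact ⟨spl F k l, fun p => (but_mulVec x u y p.1 p.2).symm⟩

theorem HCres_eq {k l : ℕ} (hk : k ≠ 0) {f : gl F (k + l) → ℂ} (hf : Invariant (k + l) f)
    (x : gl F k) (y : gl F l) : HCres k l f (x, y) = cop (ft f) (mo x) (mo y) := by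
  unfold HCres
  rw [dif_neg hk]
  split_ifs with hl
  · rw [cop_comm ft_cls, cop_zero ft_cls (by rw [dim_mo, hl])]
    exact (ft_eq hf (iso_cast _ _)).symm
  · unfold cop
    have : (avg fun u : (mo y).V →ₗ[F] (mo x).V => ft f ((mo x).ext (mo y) u)) =
        avg fun u : Matrix (Fin k) (Fin l) F => ft f ((mo x).ext (mo y) (Matrix.mulVecLin u)) :=
      (avg_equiv (Matrix.toLin' (R := F) (m := Fin k) (n := Fin l)).toEquiv
        (fun u : (Fin l → F) →ₗ[F] (Fin k → F) => ft f ((mo x).ext (mo y) u))).symm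
    rw [this]
    unfold avg
    have hc : Fintype.card (Matrix (Fin k) (Fin l) F) = Fintype.card F ^ (k * l) := by
      change Fintype.card (Fin k → Fin l → F) = _
      simp [mul_comm, ← pow_mul]
    rw [hc]
    push_cast
    exact congrArg _ (Finset.sum_congr rfl fun u _ => (ft_eq hf (iso_but x u y)).symm)

end bridge
end HCPaper

namespace HCPaper
open scoped Classical
set_option linter.unusedSectionVars false

section ind
variable {F : Type} [Field F] [Fintype F] [DecidableEq F]

theorem blk_mulVec {k l : ℕ} (m : gl F (k + l)) (p : (Fin k → F) × (Fin l → F)) :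
    m *ᵥ spl F k l p = spl F k l
      ((blk k l m).toBlocks₁₁ *ᵥ p.1 + (blk k l m).toBlocks₁₂ *ᵥ p.2,
       (blk k l m).toBlocks₂₁ *ᵥ p.1 + (blk k l m).toBlocks₂₂ *ᵥ p.2) := by
  have hm : m = Matrix.reindex finSumFinEquiv finSumFinEquiv (blk k l m) := by
    ext i j; simp [blk]
  have hb := Matrix.fromBlocks_toBlocks (blk k l m)
  conv_lhs => rw [hm, ← hb]
  change _ *ᵥ (Sum.elim p.1 p.2 ∘ finSumFinEquiv.symm) = Sum.elim _ _ ∘ finSumFinEquiv.symm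
  rw [Matrix.reindex_apply, Matrix.submatrix_mulVec_equiv]
  have : (Sum.elim p.1 p.2 ∘ ⇑finSumFinEquiv.symm) ∘ ⇑finSumFinEquiv.symm.symm
      = Sum.elim p.1 p.2 := by
    funext i; simp
  rw [this, Matrix.fromBlocks_mulVec]
  simp

/-- the standard subspace -/
def U0 (F : Type) [Field F] (k l : ℕ) : Submodule F (Fin (k + l) → F) :=
  LinearMap.ker (LinearMap.snd F (Fin k → F) (Fin l → F) ∘ₗ (spl F k l).symm.toLinearMap)

theorem mem_U0 {k l : ℕ} (p : (Fin k → F) × (Fin l → F)) : spl F k l p ∈ U0 F k l ↔ p.2 = 0 := by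
  simp [U0]

theorem U0_finrank (k l : ℕ) : Module.finrank F (U0 F k l) = k := by
  have h1 := LinearMap.finrank_range_add_finrank_ker
    (LinearMap.snd F (Fin k → F) (Fin l → F) ∘ₗ (spl F k l).symm.toLinearMap)
  have h2 : LinearMap.range
      (LinearMap.snd F (Fin k → F) (Fin l → F) ∘ₗ (spl F k l).symm.toLinearMap) = ⊤ := by
    rw [LinearMap.range_eq_top]
    intro y
    exact ⟨spl F k l (0, y), by simp⟩
  rw [h2] at h1
  simp only [finrank_top, Module.finrank_fin_fun] at h1
  change l + Module.finrank F (U0 F k l) = k + l at h1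
  omega

theorem isBUT_iff {k l : ℕ} (m : gl F (k + l)) :
    IsBUT k l m ↔ ∀ v ∈ U0 F k l, m *ᵥ v ∈ U0 F k l := by
  constructor
  · intro h v hv
    obtain ⟨p, rfl⟩ := (spl F k l).surjective v
    rw [mem_U0] at hv
    rw [blk_mulVec, mem_U0]
    unfold IsBUT at h
    simp [h, hv]
  · intro h
    unfold IsBUT
    apply Matrix.mulVec_injective
    funext a
    have := h (spl F k l (a, 0)) ((mem_U0 _).2 rfl)
    rw [blk_mulVec, mem_U0] at this
    simpa using this

/-- `W_g` -/
noncomputable def Wg {k l : ℕ} (g : Matrix.GeneralLinearGroup (Fin (k + l)) F) :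
    Submodule F (Fin (k + l) → F) := (U0 F k l).comap (gam g).toLinearMap

theorem mem_Wg {k l : ℕ} (g : Matrix.GeneralLinearGroup (Fin (k + l)) F) (v : Fin (k + l) → F) :
    v ∈ Wg g ↔ gam g v ∈ U0 F k l := Iff.rfl

theorem Wg_map {k l : ℕ} (g : Matrix.GeneralLinearGroup (Fin (k + l)) F) :
    (Wg g).map (gam g).toLinearMap = U0 F k l :=
  Submodule.map_comap_eq_of_surjective (gam g).surjective _

theorem Wg_finrank {k l : ℕ} (g : Matrix.GeneralLinearGroup (Fin (k + l)) F) :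
    Module.finrank F (Wg g) = k := by
  have := LinearEquiv.finrank_map_eq (gam g) (Wg g)
  have h2 := congrArg (fun W : Submodule F (Fin (k + l) → F) => Module.finrank F W) (Wg_map g)
  simp only [U0_finrank] at h2
  rw [← this]; exact h2

theorem Wg_stable {k l : ℕ} (g : Matrix.GeneralLinearGroup (Fin (k + l)) F) (z : gl F (k + l)) :
    IsBUT k l (conjM g z) ↔ ∀ v ∈ Wg g, z *ᵥ v ∈ Wg g := by
  rw [isBUT_iff]
  constructor
  · intro h v hv
    rw [mem_Wg, gam_conj]
    exact h _ hv
  · intro h v hv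
    obtain ⟨w, rfl⟩ := (gam g).surjective v
    rw [← gam_conj]
    exact h w hv

theorem iso_sub_Wg {k l : ℕ} (g : Matrix.GeneralLinearGroup (Fin (k + l)) F) (z : gl F (k + l))
    (W : Stab (mo z)) (hW : W.1 = Wg g) :
    Iso (mo (proj k l (conjM g z)).1) ((mo z).sub W) ∧
    Iso (mo (proj k l (conjM g z)).2) ((mo z).quo W) := by
  have hb : IsBUT k l (conjM g z) := (Wg_stable g z).2 fun v hv => by
    rw [← hW] at hv ⊢
    exact W.2 hv
  have hst : U0 F k l ≤ (U0 F k l).comap (Matrix.mulVecLin (conjM g z)) :=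
    fun v hv => (isBUT_iff _).1 hb v hv
  let W' : Stab (mo (conjM g z)) := ⟨U0 F k l, hst⟩
  have hm : W.1.map (gam g).toLinearMap = W'.1 := by
    refine (congrArg (Submodule.map (gam g).toLinearMap) hW).trans (Wg_map g)
  have i1 : Iso ((mo z).sub W) ((mo (conjM g z)).sub W') :=
    iso_sub (A := mo z) (B := mo (conjM g z)) (gam g) (fun v => gam_conj g z v) W W' hm
  have i2 : Iso ((mo z).quo W) ((mo (conjM g z)).quo W') :=
    iso_quo (A := mo z) (B := mo (conjM g z)) (gam g) (fun v => gam_conj g z v) W W' hm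
  unfold IsBUT at hb
  constructor
  · refine Iso.trans ?_ i1.symm
    let J : (Fin k → F) →ₗ[F] (Fin (k + l) → F) :=
      (spl F k l).toLinearMap ∘ₗ LinearMap.inl F (Fin k → F) (Fin l → F)
    have hJ : ∀ c, J c = spl F k l (c, 0) := fun c => rfl
    have hJi : Function.Injective J := fun a b hab =>
      congrArg Prod.fst ((spl F k l).injective hab)
    refine iso_sub_of (mo (conjM g z)) (mo (proj k l (conjM g z)).1) W' J hJi ?_ ?_
    · intro v
      obtain ⟨p, rfl⟩ := (spl F k l).surjective v
      refine (mem_U0 p).trans ?_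
      constructor
      · intro h
        exact ⟨p.1, congrArg (spl F k l) (Prod.ext rfl h.symm)⟩
      · rintro ⟨c, hc⟩
        have := (spl F k l).injective hc
        exact (congrArg Prod.snd this).symm
    · have key : ∀ c : Fin k → F, J ((blk k l (conjM g z)).toBlocks₁₁ *ᵥ c) =
          conjM g z *ᵥ (J c) := by
        intro c
        rw [hJ, hJ, blk_mulVec, hb]
        simp
      exact key
  · refine Iso.symm (Iso.trans i2 ?_)
    let p : (Fin (k + l) → F) →ₗ[F] (Fin l → F) :=
      LinearMap.snd F (Fin k → F) (Fin l → F) ∘ₗ (spl F k l).symm.toLinearMap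
    have hp : ∀ q, p (spl F k l q) = q.2 := fun q => by simp [p]
    have hps : Function.Surjective p := fun y => ⟨spl F k l (0, y), hp _⟩
    refine iso_quo_of (mo (conjM g z)) (mo (proj k l (conjM g z)).2) W' p hps
      (fun v => Iff.rfl) ?_
    have key : ∀ v : Fin (k + l) → F, p (conjM g z *ᵥ v) =
        (blk k l (conjM g z)).toBlocks₂₂ *ᵥ (p v) := by
      intro v
      obtain ⟨q, rfl⟩ := (spl F k l).surjective v
      rw [blk_mulVec, hb, hp, hp]
      simp
    exact key

theorem exists_g {k l : ℕ} (W : Submodule F (Fin (k + l) → F)) (hW : Module.finrank F W = k) :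
    ∃ g : Matrix.GeneralLinearGroup (Fin (k + l)) F, Wg g = W := by
  obtain ⟨C, hC⟩ := W.exists_isCompl
  obtain ⟨C', hC'⟩ := (U0 F k l).exists_isCompl
  have h1 := Submodule.finrank_add_eq_of_isCompl hC
  have h2 := Submodule.finrank_add_eq_of_isCompl hC'
  rw [U0_finrank] at h2
  have e1 : W ≃ₗ[F] U0 F k l := LinearEquiv.ofFinrankEq _ _ (by rw [hW, U0_finrank])
  have e2 : C ≃ₗ[F] C' := LinearEquiv.ofFinrankEq _ _ (by omega)
  let e : (Fin (k + l) → F) ≃ₗ[F] (Fin (k + l) → F) :=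
    (W.prodEquivOfIsCompl C hC).symm.trans ((e1.prodCongr e2).trans
      ((U0 F k l).prodEquivOfIsCompl C' hC'))
  obtain ⟨g, hg⟩ := gam_surj e
  refine ⟨g, ?_⟩
  symm
  apply Submodule.eq_of_le_of_finrank_eq
  · intro v hv
    rw [mem_Wg, hg]
    have : (W.prodEquivOfIsCompl C hC).symm v = (⟨v, hv⟩, 0) :=
      Submodule.prodEquivOfIsCompl_symm_apply_left (p := W) (q := C) (h := hC) (⟨v, hv⟩ : W)
    have h4 : e v = ((e1 ⟨v, hv⟩ : U0 F k l) : Fin (k + l) → F) := by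
      simp only [e, LinearEquiv.trans_apply, this, LinearEquiv.prodCongr_apply, map_zero]
      simp
    rw [h4]
    exact (e1 ⟨v, hv⟩).2
  · rw [hW, Wg_finrank]

theorem card_fibre {k l : ℕ} (W : Submodule F (Fin (k + l) → F)) (hW : Module.finrank F W = k) :
    (Finset.univ.filter fun g : Matrix.GeneralLinearGroup (Fin (k + l)) F => W = Wg g).card =
      Pcard F k l := by
  obtain ⟨g0, rfl⟩ := exists_g W hW
  rw [Pcard, Nat.card_eq_fintype_card, Fintype.card_subtype]
  symm
  refine Finset.card_bij (fun p _ => p * g0) ?_ ?_ ?_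
  · intro p hp
    rw [Finset.mem_filter] at hp ⊢
    refine ⟨Finset.mem_univ _, ?_⟩
    apply Submodule.eq_of_le_of_finrank_eq
    · intro v hv
      rw [mem_Wg, gam_mul]
      exact (isBUT_iff _).1 hp.2 _ hv
    · rw [Wg_finrank, Wg_finrank]
  · intro p _ p' _ h
    exact mul_right_cancel h
  · intro g hg
    rw [Finset.mem_filter] at hg
    refine ⟨g * g0⁻¹, ?_, by simp⟩
    rw [Finset.mem_filter]
    refine ⟨Finset.mem_univ _, ?_⟩
    rw [isBUT_iff]
    intro v hv
    obtain ⟨w, rfl⟩ := (gam g0).surjective v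
    change gam (g * g0⁻¹) (gam g0 w) ∈ _
    rw [← gam_mul, inv_mul_cancel_right, ← mem_Wg, ← hg.2]
    exact hv

theorem Pcard_ne_zero (k l : ℕ) : (Pcard F k l : ℂ) ≠ 0 := by
  have : Pcard F k l ≠ 0 := by
    rw [← card_fibre (U0 F k l) (U0_finrank k l)]
    obtain ⟨g, hg⟩ := exists_g (U0 F k l) (U0_finrank k l)
    exact Finset.card_ne_zero_of_mem (Finset.mem_filter.2 ⟨Finset.mem_univ g, hg.symm⟩)
  exact_mod_cast this

theorem iso_dim_zero {A B : Obj F} (hA : A.dim = 0) (hB : B.dim = 0) : Iso A B := by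
  have := subsingleton_of_dim hA
  have := subsingleton_of_dim hB
  exact ⟨LinearEquiv.ofSubsingleton _ _, fun v => Subsingleton.elim _ _⟩

theorem HCind_eq {k l : ℕ} (hk : k ≠ 0) {H : Obj F → Obj F → ℂ} (hH : Cls2 H)
    {h : gl F k × gl F l → ℂ} (hh : ∀ x y, h (x, y) = H (mo x) (mo y)) (z : gl F (k + l)) :
    HCind k l h z = ∑ W : Stab (mo z), if ((mo z).sub W).dim = k then
      H ((mo z).sub W) ((mo z).quo W) else 0 := by
  unfold HCind
  rw [dif_neg hk]
  split_ifs with hl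
  · let T : Stab (mo z) := ⟨⊤, fun _ _ => trivial⟩
    have iT : Iso (mo z) ((mo z).sub T) :=
      iso_sub_of (mo z) (mo z) T LinearMap.id Function.injective_id
        (fun a => ⟨fun _ => ⟨a, rfl⟩, fun _ => trivial⟩) (fun _ => rfl)
    have dT : ((mo z).sub T).dim = k := by
      rw [← iT.dim, dim_mo, hl, add_zero]
    rw [Finset.sum_eq_single T]
    · rw [if_pos dT]
      refine (hh _ _).trans ?_
      refine hH _ _ _ _ ((iso_cast _ _).trans iT) (iso_dim_zero (by rw [dim_mo, hl]) ?_)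
      have := dim_sub_quo (mo z) T
      rw [dim_mo] at this
      omega
    · intro W _ hW
      rw [if_neg]
      intro hd
      apply hW
      apply Subtype.ext
      apply Submodule.eq_top_of_finrank_eq
      have h1 : Module.finrank F (mo z).V = k + l := dim_mo z
      have h2 : Module.finrank F W.1 = k := hd
      rw [h1, h2, hl, add_zero]
    · simp
  · have h1 : ∀ g : Matrix.GeneralLinearGroup (Fin (k + l)) F,
        (if IsBUT k l (conjM g z) then h (proj k l (conjM g z)) else 0) =
        ∑ W : Stab (mo z), if (W.1 : Submodule F (Fin (k + l) → F)) = Wg g then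
          H ((mo z).sub W) ((mo z).quo W) else 0 := by
      intro g
      split_ifs with hb
      · let W : Stab (mo z) := ⟨Wg g, fun v hv => (Wg_stable g z).1 hb v hv⟩
        rw [Finset.sum_eq_single W]
        · rw [if_pos rfl]
          obtain ⟨i1, i2⟩ := iso_sub_Wg g z W rfl
          rw [← hH _ _ _ _ i1 i2, ← hh]
        · intro W' _ hW'
          rw [if_neg]
          intro h'
          exact hW' (Subtype.ext h')
        · simp
      · symm
        apply Finset.sum_eq_zero
        intro W _
        rw [if_neg]
        intro h'
        apply hb
        rw [Wg_stable]
        intro v hv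
        rw [← h'] at hv ⊢
        exact W.2 hv
    simp only [h1]
    rw [Finset.sum_comm, Finset.mul_sum]
    refine Finset.sum_congr rfl fun W _ => ?_
    rw [← Finset.sum_filter, Finset.sum_const, nsmul_eq_mul]
    split_ifs with hd
    · have hc : (Finset.univ.filter fun g : Matrix.GeneralLinearGroup (Fin (k + l)) F =>
          (W.1 : Submodule F (Fin (k + l) → F)) = Wg g).card = Pcard F k l :=
        card_fibre (k := k) (l := l) W.1 hd
      refine (congrArg (fun N : ℕ => (Pcard F k l : ℂ)⁻¹ *
        ((N : ℂ) * H ((mo z).sub W) ((mo z).quo W))) hc).trans ?_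
      rw [← mul_assoc, inv_mul_cancel₀ (Pcard_ne_zero k l), one_mul]
    · have : (Finset.univ.filter fun g : Matrix.GeneralLinearGroup (Fin (k + l)) F =>
          (W.1 : Submodule F (Fin (k + l) → F)) = Wg g) = ∅ := by
        apply Finset.filter_eq_empty_iff.2
        intro g _ hg
        apply hd
        have := Wg_finrank g
        rw [← hg] at this
        exact this
      rw [this]; simp

end ind
end HCPaper

namespace HCPaper
open scoped Classical
set_option linter.unusedSectionVars false

section comp
variable {F : Type} [Field F]

noncomputable def E : List ℕ → Obj F → (Obj F → ℂ) → ℂ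
  | [], A, f => f A
  | (k :: L), A, f => ∑ W : Stab A, if (A.sub W).dim = k then E L (A.quo W) (cop f (A.sub W)) else 0

theorem E_mem (L : List ℕ) (A : Obj F) : E L A ∈ S F A.dim := by
  induction L generalizing A with
  | nil => exact S_ev A
  | cons k L ih =>
    have : E (k :: L) A = ∑ W : Stab A, (if (A.sub W).dim = k then
        (fun f : Obj F → ℂ => E L (A.quo W) (cop f (A.sub W))) else (0 : (Obj F → ℂ) → ℂ)) := by
      funext f
      rw [E, Finset.sum_apply]
      refine Finset.sum_congr rfl fun W _ => ?_
      split_ifs <;> simp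
    rw [this]
    refine Submodule.sum_mem _ fun W _ => ?_
    split_ifs
    · rw [← dim_sub_quo A W]
      exact S_cop (ih _) _
    · exact Submodule.zero_mem _

theorem E_iso (L : List ℕ) {f : Obj F → ℂ} (hf : Cls f) {A B : Obj F} (i : Iso A B) :
    E L A f = E L B f := by
  induction L generalizing A B f with
  | nil => exact hf _ _ i
  | cons k L ih =>
    obtain ⟨e, he⟩ := i
    rw [E, E, ← Equiv.sum_comp (stabEquiv e he)]
    refine Finset.sum_congr rfl fun W _ => ?_
    have i1 : Iso (A.sub W) (B.sub (stabEquiv e he W)) := iso_sub e he _ _ rfl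
    have i2 : Iso (A.quo W) (B.quo (stabEquiv e he W)) := iso_quo e he _ _ rfl
    have hc : cop f (A.sub W) = cop f (B.sub (stabEquiv e he W)) :=
      funext fun Q => (cop_cls hf).left Q _ _ i1
    rw [i1.dim, ← hc, ih ((cop_cls hf).right _) i2]

/-- prepending a block -/
def consComp {n m d : ℕ} (hd : 0 < d) (h : d + m = n) (c : Composition m) : Composition n :=
  ⟨d :: c.blocks, by
    intro i hi
    rcases List.mem_cons.1 hi with rfl | hi
    · exact hd
    · exact c.blocks_pos hi, by rw [List.sum_cons, c.blocks_sum, h]⟩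

theorem D_eq_sum (n : ℕ) (A : Obj F) (hA : A.dim = n) (f : Obj F → ℂ) :
    D A f = ∑ c : Composition n, (-1 : ℂ) ^ (n - c.length) * E c.blocks A f := by
  induction n using Nat.strong_induction_on generalizing A f with
  | _ n ih =>
  by_cases h0 : n = 0
  · subst h0
    rw [D_zero hA]
    have hb : ∀ c : Composition 0, c.blocks = [] := by
      intro c
      by_contra hne
      obtain ⟨a, ha⟩ := List.exists_mem_of_ne_nil _ hne
      have h1 := c.blocks_pos ha
      have h2 := List.le_sum_of_mem ha
      rw [c.blocks_sum] at h2
      omega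
    have : ∀ c : Composition 0, (-1 : ℂ) ^ (0 - c.length) * E c.blocks A f = f A := by
      intro c
      rw [hb c, E]; simp
    simp only [this]
    rw [Finset.sum_const, Finset.card_univ, composition_card]
    simp
  · rw [D_pos (by omega)]
    let ψ : Stab A → Composition n → ℂ := fun W c =>
      (-1 : ℂ) ^ (n - c.length) * (match c.blocks with
        | [] => 0
        | (k :: L) => if (A.sub W).dim = k then E L (A.quo W) (cop f (A.sub W)) else 0)
    have hψ : ∀ c : Composition n, (-1 : ℂ) ^ (n - c.length) * E c.blocks A f = ∑ W, ψ W c := by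
      intro c
      simp only [ψ]
      rw [← Finset.mul_sum]
      congr 1
      cases hb : c.blocks with
      | nil =>
        exfalso
        have := c.blocks_sum
        rw [hb] at this
        exact h0 this.symm
      | cons k L => rw [E]
    simp only [hψ]
    rw [Finset.sum_comm]
    refine Finset.sum_congr rfl fun W _ => ?_
    split_ifs with hW
    · symm
      apply Finset.sum_eq_zero
      intro c _
      simp only [ψ]
      cases hb : c.blocks with
      | nil => simp
      | cons k L =>
        have : 0 < k := c.blocks_pos (by rw [hb]; simp)
        have hd : (A.sub W).dim = 0 := (dim_sub_eq_zero A W).2 hW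
        simp only []
        rw [if_neg (by omega), mul_zero]
    · have hdm := dim_sub_quo A W
      rw [hA] at hdm
      have hpos := dim_sub_pos hW
      rw [ih _ (by omega) (A.quo W) rfl, Finset.mul_sum]
      have hinj : Function.Injective (consComp (n := n) hpos hdm) := by
        intro c c' h
        have := congrArg Composition.blocks h
        exact Composition.ext (List.cons.inj this).2
      rw [← Finset.sum_subset (Finset.subset_univ (Finset.univ.image (consComp (n := n) hpos hdm))),
        Finset.sum_image (fun _ _ _ _ h => hinj h)]
      · refine Finset.sum_congr rfl fun c _ => ?_
        simp only [ψ, consComp]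
        rw [if_pos trivial, ← mul_assoc]
        congr 1
        rw [← pow_add]
        have h1 := c.length_le
        have h2 : (Composition.length ⟨(A.sub W).dim :: c.blocks, (consComp hpos hdm c).blocks_pos,
          (consComp hpos hdm c).blocks_sum⟩ : ℕ) = c.length + 1 := rfl
        have h3 : (A.sub W).dim + 1 + ((A.quo W).dim - c.length) =
          (n - (c.length + 1)) + 2 := by omega
        rw [h3, pow_add]
        simp [Composition.length]
      · intro c _ hc
        simp only [ψ]
        cases hb : c.blocks with
        | nil => simp
        | cons k L =>
          simp only []
          rw [if_neg, mul_zero]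
          intro hk
          apply hc
          rw [Finset.mem_image]
          have hs := c.blocks_sum
          rw [hb, List.sum_cons, ← hk] at hs
          refine ⟨⟨L, fun {i} hi => c.blocks_pos (by rw [hb]; exact List.mem_cons_of_mem _ hi),
            by omega⟩, Finset.mem_univ _, ?_⟩
          apply Composition.ext
          refine Eq.trans ?_ hb.symm
          exact congrArg (fun d => d :: L) hk

end comp

section final
variable {F : Type} [Field F] [Fintype F] [DecidableEq F]

theorem HCres_inv {k l : ℕ} (hk : k ≠ 0) {f : gl F (k + l) → ℂ} (hf : Invariant (k + l) f)
    (x : gl F k) : Invariant l (fun y => HCres k l f (x, y)) :=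
  inv_of_cls ((cop_cls ft_cls).right (mo x)) (fun y => HCres_eq hk hf x y)

theorem RcompRes_eq (L : List ℕ) (hL : ∀ k ∈ L, 0 < k) {f : gl F L.sum → ℂ}
    (hf : Invariant L.sum f) (x : gl F L.sum) : RcompRes L f x = E L (mo x) (ft f) := by
  induction L with
  | nil => exact (ft_eq hf (Iso.refl _)).symm
  | cons k L ih =>
    have hk : k ≠ 0 := (hL k (by simp)).ne'
    have hL' : ∀ k ∈ L, 0 < k := fun j hj => hL j (List.mem_cons_of_mem _ hj)
    rw [RcompRes, castFun]
    have hf' : Invariant (k + L.sum) (castFun List.sum_cons f) := inv_cast _ hf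
    have hH : Cls2 (fun P Q => E L Q (cop (ft (castFun List.sum_cons f)) P)) := by
      intro A A' B B' i j
      have : cop (ft (castFun List.sum_cons f)) A = cop (ft (castFun List.sum_cons f)) A' :=
        funext fun Q => (cop_cls ft_cls).left Q _ _ i
      simp only [this]
      exact E_iso L ((cop_cls ft_cls).right _) j
    rw [HCind_eq hk hH]
    · have h1 : E (k :: L) (mo x) (ft f) = E (k :: L) (mo (castM List.sum_cons x))
          (ft (castFun List.sum_cons f)) := by
        rw [ft_cast]
        exact E_iso _ ft_cls (iso_cast _ _).symm
      rw [h1]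
      rfl
    · intro x y
      rw [ih hL' (HCres_inv hk hf' x)]
      refine S_local (E_mem L (mo y)) fun O hO => ?_
      rw [dim_mo] at hO
      obtain ⟨w, iw⟩ := exists_mo O hO
      rw [ft_eq (HCres_inv hk hf' x) iw, HCres_eq hk hf']
      exact (cop_cls ft_cls).right _ _ _ iw

theorem Dual_eq {n : ℕ} {f : gl F n → ℂ} (hf : Invariant n f) (x : gl F n) :
    Dual n f x = D (mo x) (ft f) := by
  rw [D_eq_sum n (mo x) (dim_mo x)]
  unfold Dual
  rw [Finset.sum_apply]
  refine Finset.sum_congr rfl fun c _ => ?_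
  rw [Pi.smul_apply, smul_eq_mul, castFun, RcompRes_eq _ (fun k hk => c.blocks_pos hk)
    (inv_cast _ hf), ft_cast, E_iso _ ft_cls (iso_cast _ _)]

theorem Dual_inv {n : ℕ} {f : gl F n → ℂ} (hf : Invariant n f) : Invariant n (Dual n f) :=
  inv_of_cls (D_cls ft_cls) (fun x => Dual_eq hf x)

theorem Dual_Dual {n : ℕ} {f : gl F n → ℂ} (hf : Invariant n f) : Dual n (Dual n f) = f := by
  funext x
  rw [Dual_eq (Dual_inv hf)]
  have : D (mo x) (ft (Dual n f)) = D (mo x) (fun P => D P (ft f)) := by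
    refine S_local (D_mem _) fun O hO => ?_
    rw [dim_mo] at hO
    obtain ⟨w, iw⟩ := exists_mo O hO
    rw [ft_eq (Dual_inv hf) iw, Dual_eq hf]
    exact D_iso ft_cls iw
  rw [this, D_D ft_cls, ft_eq hf (Iso.refl _)]

/-- unnormalized pairing -/
noncomputable def pr {X : Type} [Fintype X] (f g : X → ℂ) : ℂ := ∑ x, f x * (starRingEnd ℂ) (g x)

theorem pr_conj {X : Type} [Fintype X] (f g : X → ℂ) : (starRingEnd ℂ) (pr f g) = pr g f := by
  unfold pr
  rw [map_sum]
  refine Finset.sum_congr rfl fun x _ => ?_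
  rw [map_mul, Complex.conj_conj, mul_comm]

theorem pr_cast {m n : ℕ} (h : m = n) (f : gl F m → ℂ) (g : gl F n → ℂ) :
    pr (castFun h f) g = pr f (castFun h.symm g) := by
  subst h
  rw [castFun_rfl, castFun_rfl]

def conjEquiv {n : ℕ} (g : Matrix.GeneralLinearGroup (Fin n) F) : gl F n ≃ gl F n where
  toFun := conjM g
  invFun := conjM g⁻¹
  left_inv x := by
    simp only [conjM, inv_inv, mul_assoc]
    rw [← Units.val_mul]
    simp only [← mul_assoc]
    rw [← Units.val_mul]
    simp
  right_inv x := by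
    simp only [conjM, inv_inv, mul_assoc]
    rw [← Units.val_mul]
    simp only [← mul_assoc]
    rw [← Units.val_mul]
    simp

def butEquiv (k l : ℕ) : ((gl F k × gl F l) × Matrix (Fin k) (Fin l) F) ≃
    {m : gl F (k + l) // IsBUT k l m} where
  toFun p := ⟨but k l p.1.1 p.2 p.1.2, by
    unfold IsBUT but blk
    ext i j; simp [Matrix.toBlocks₂₁]⟩
  invFun m := (proj k l m.1, (blk k l m.1).toBlocks₁₂)
  left_inv p := by
    refine Prod.ext (Prod.ext ?_ ?_) ?_ <;>
      (ext i j; simp [proj, blk, but, Matrix.toBlocks₁₁, Matrix.toBlocks₂₂, Matrix.toBlocks₁₂])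
  right_inv m := by
    apply Subtype.ext
    have h := m.2
    unfold IsBUT at h
    have hb := Matrix.fromBlocks_toBlocks (blk k l m.1)
    rw [h] at hb
    change Matrix.reindex finSumFinEquiv finSumFinEquiv (Matrix.fromBlocks (blk k l m.1).toBlocks₁₁
      (blk k l m.1).toBlocks₁₂ 0 (blk k l m.1).toBlocks₂₂) = m.1
    rw [hb]
    ext i j; simp [blk]

theorem adj {k : ℕ} (l : ℕ) (hk : k ≠ 0) : ∃ c : ℝ, ∀ (h : gl F k × gl F l → ℂ)
    (g : gl F (k + l) → ℂ), Invariant (k + l) g →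
    pr (HCind k l h) g = c * pr h (HCres k l g) := by
  by_cases hl : l = 0
  · subst hl
    refine ⟨1, fun h g _ => ?_⟩
    unfold pr HCind HCres
    simp only [dif_neg hk, dif_pos]
    rw [Fintype.sum_prod_type, Complex.ofReal_one, one_mul]
    refine Finset.sum_congr rfl fun x _ => ?_
    rw [Fintype.sum_eq_single (0 : gl F 0)]
    · rfl
    · intro y hy
      exact absurd (Subsingleton.elim y 0) hy
  · refine ⟨(Pcard F k l : ℝ)⁻¹ * (Fintype.card (Matrix.GeneralLinearGroup (Fin (k + l)) F)) *
      (Fintype.card F : ℝ) ^ (k * l), fun h g hg => ?_⟩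
    have hq : (Fintype.card F : ℂ) ^ (k * l) ≠ 0 := by
      apply pow_ne_zero
      exact_mod_cast Fintype.card_ne_zero
    unfold pr HCind HCres
    simp only [dif_neg hk, dif_neg hl]
    have h1 : ∑ p : gl F k × gl F l, h p * (starRingEnd ℂ) (((Fintype.card F : ℂ) ^ (k * l))⁻¹ *
        ∑ u, g (but k l p.1 u p.2)) = ((Fintype.card F : ℂ) ^ (k * l))⁻¹ *
        ∑ m : gl F (k + l), (if IsBUT k l m then h (proj k l m) else 0) *
          (starRingEnd ℂ) (g m) := by
      have h2 : ∑ m : gl F (k + l), (if IsBUT k l m then h (proj k l m) else 0) *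
          (starRingEnd ℂ) (g m) = ∑ m : {m : gl F (k + l) // IsBUT k l m},
            h (proj k l m.1) * (starRingEnd ℂ) (g m.1) := by
        simp only [ite_mul, zero_mul]
        refine (Finset.sum_filter (s := Finset.univ) (fun m : gl F (k + l) => IsBUT k l m)
          (fun m => h (proj k l m) * (starRingEnd ℂ) (g m))).symm.trans ?_
        convert Finset.sum_subtype (p := fun m : gl F (k + l) => IsBUT k l m)
          (Finset.univ.filter fun m : gl F (k + l) => IsBUT k l m) (fun m => by simp)
          (fun m => h (proj k l m) * (starRingEnd ℂ) (g m))
      rw [h2, ← Equiv.sum_comp (butEquiv k l)]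
      conv_rhs => rw [Fintype.sum_prod_type, Finset.mul_sum]
      refine Finset.sum_congr rfl fun p _ => ?_
      have h3 : ∀ u, proj k l (but k l p.1 u p.2) = p := fun u =>
        congrArg Prod.fst ((butEquiv (F := F) k l).left_inv (p, u))
      simp only [butEquiv, Equiv.coe_fn_mk, h3]
      rw [← Finset.mul_sum]
      simp only [map_mul, map_sum, map_inv₀, map_pow, map_natCast]
      ring
    rw [h1]
    have h4 : ∀ a : Matrix.GeneralLinearGroup (Fin (k + l)) F,
        ∑ z : gl F (k + l), (if IsBUT k l (conjM a z) then h (proj k l (conjM a z)) else 0) *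
          (starRingEnd ℂ) (g z) =
        ∑ m : gl F (k + l), (if IsBUT k l m then h (proj k l m) else 0) *
          (starRingEnd ℂ) (g m) := by
      intro a
      conv_rhs => rw [← Equiv.sum_comp (conjEquiv a)]
      refine Finset.sum_congr rfl fun z _ => ?_
      simp only [conjEquiv, Equiv.coe_fn_mk]
      rw [hg a z]
      congr!
    simp only [mul_assoc, Finset.sum_mul, ← Finset.mul_sum]
    rw [Finset.sum_comm]
    simp only [h4]
    rw [Finset.sum_const, Finset.card_univ, nsmul_eq_mul]
    push_cast
    field_simp

theorem Rcomp_adj (L : List ℕ) (hL : ∀ k ∈ L, 0 < k) {f g : gl F L.sum → ℂ}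
    (hf : Invariant L.sum f) (hg : Invariant L.sum g) :
    pr (RcompRes L f) g = pr f (RcompRes L g) := by
  induction L with
  | nil => rfl
  | cons k L ih =>
    have hk : k ≠ 0 := (hL k (by simp)).ne'
    have hL' : ∀ k ∈ L, 0 < k := fun j hj => hL j (List.mem_cons_of_mem _ hj)
    have hf' : Invariant (k + L.sum) (castFun List.sum_cons f) := inv_cast _ hf
    have hg' : Invariant (k + L.sum) (castFun List.sum_cons g) := inv_cast _ hg
    obtain ⟨c, hc⟩ := adj (F := F) L.sum hk
    rw [← pr_conj (RcompRes (k :: L) g) f]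
    rw [RcompRes, RcompRes, pr_cast, pr_cast, hc _ _ hf', hc _ _ hg', map_mul, pr_conj,
      Complex.conj_ofReal]
    congr 1
    unfold pr
    rw [Fintype.sum_prod_type, Fintype.sum_prod_type]
    refine Finset.sum_congr rfl fun x _ => ?_
    exact ih hL' (HCres_inv hk hf' x) (HCres_inv hk hg' x)

theorem Dual_adj {n : ℕ} {f g : gl F n → ℂ} (hf : Invariant n f) (hg : Invariant n g) :
    pr (Dual n f) g = pr f (Dual n g) := by
  have h1 : pr (Dual n f) g = ∑ c : Composition n, (-1 : ℂ) ^ (n - c.length) *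
      pr (castFun c.blocks_sum (RcompRes c.blocks (castFun c.blocks_sum.symm f))) g := by
    unfold pr Dual
    simp only [Finset.sum_apply, Pi.smul_apply, smul_eq_mul, Finset.sum_mul, Finset.mul_sum]
    rw [Finset.sum_comm]
    simp only [mul_assoc]
  have h2 : pr f (Dual n g) = ∑ c : Composition n, (-1 : ℂ) ^ (n - c.length) *
      pr f (castFun c.blocks_sum (RcompRes c.blocks (castFun c.blocks_sum.symm g))) := by
    unfold pr Dual
    simp only [Finset.sum_apply, Pi.smul_apply, smul_eq_mul, Finset.mul_sum, map_sum, map_mul,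
      map_pow, map_neg, map_one]
    rw [Finset.sum_comm]
    simp only [mul_left_comm]
  rw [h1, h2]
  refine Finset.sum_congr rfl fun c _ => ?_
  congr 1
  rw [pr_cast, Rcomp_adj _ (fun k hk => c.blocks_pos hk) (inv_cast _ hf) (inv_cast _ hg), pr_cast]

end final

/-- the duality operation is isometric. -/
theorem dual_isometric (F : Type) [Field F] [Fintype F] [DecidableEq F] (n : ℕ)
    (f g : gl F n → ℂ) (hf : Invariant n f) (hg : Invariant n g) :
    inn n (Dual n f) (Dual n g) = inn n f g := by
  unfold inn
  congr 1
  have := Dual_adj hf (Dual_inv hg)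
  rw [Dual_Dual hg] at this
  exact this

end HCPaper
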